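/- arXiv:2402.04428 — 2 statements merged into one kernel-verified Lean document; each statement's English description precedes it below -/
import Mathlib

section
/- Let a > 2 and b > 1 be coprime integers and let r be a positive integer, and fix u, v ∈ {0, 1}. For each prime p dividing a, let n_p be the least positive integer n such that p divides b^n − 1 or p divides b^n + 1, set g_p = max(ν_p(b^{n_p} − 1), ν_p(b^{n_p} + 1)), and set S = (Σ_{p prime, p ∣ a} g_p·log p)/log a. Suppose (x₁,y₁) and (x₂,y₂) are two distinct pairs of positive integers each satisfying (−1)^u·a^x + (−1)^v·b^y = r, with x₁ ≤ x₂ and y₁ ≤ y₂, and suppose a^{x₁} > r/2. Then x₁ < S + k, where k = (8.1 + log(log a))/log(a) if a < 5346, and k = 1.19408 if a ≥ 5346. -/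
/-- A matrix with linearly independent rows has an invertible maximal minor. -/
theorem Matrix.exists_det_submatrix_ne_zero {m n F : Type*} [Fintype m] [DecidableEq m] [Fintype n]
    [Field F] (M : Matrix m n F) (hM : LinearIndependent F M.row) :
    ∃ f : m → n, Function.Injective f ∧ (M.submatrix id f).det ≠ 0 := by
  obtain ⟨f, hf, -, hli⟩ := Submodule.exists_fun_fin_finrank_span_eq F (Set.range M.col)
  have hr : Module.finrank F (Submodule.span F (Set.range M.col)) = Fintype.card m := by
    rw [← Matrix.rank_eq_finrank_span_cols, LinearIndependent.rank_matrix hM]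
  choose g hg using hf
  let e : m ≃ Fin (Module.finrank F (Submodule.span F (Set.range M.col))) :=
    (Fintype.equivFin m).trans (finCongr hr.symm)
  have hli' : LinearIndependent F (fun i => M.col (g (e i))) := by
    have : (fun i => M.col (g (e i))) = f ∘ e := by
      funext i; exact hg (e i)
    rw [this]
    exact hli.comp _ e.injective
  refine ⟨fun i => g (e i), ?_, ?_⟩
  · intro i j hij
    exact hli'.injective (by simp only [hij])
  · have h1 : LinearIndependent F (M.submatrix id (fun i => g (e i))).col := hli'
    rw [Matrix.linearIndependent_cols_iff_isUnit, Matrix.isUnit_iff_isUnit_det] at h1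
    exact h1.ne_zero

theorem Polynomial.coeff_prod_sum_of_natDegree_le {R ι : Type*} [CommSemiring R] (s : Finset ι)
    (f : ι → Polynomial R) (d : ι → ℕ) (h : ∀ i ∈ s, (f i).natDegree ≤ d i) :
    (∏ i ∈ s, f i).coeff (∑ i ∈ s, d i) = ∏ i ∈ s, (f i).coeff (d i) := by
  classical
  induction s using Finset.induction_on with
  | empty => simp
  | insert a s ha ih =>
    rw [Finset.prod_insert ha, Finset.prod_insert ha, Finset.sum_insert ha,
      Polynomial.coeff_mul_add_eq_of_natDegree_le (h a (Finset.mem_insert_self a s)), ih]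
    · exact fun i hi => h i (Finset.mem_insert_of_mem hi)
    · exact (Polynomial.natDegree_prod_le s f).trans
        (Finset.sum_le_sum fun i hi => h i (Finset.mem_insert_of_mem hi))

open Polynomial in
/-- A family of polynomials `P l` of degree less than `K` such that `∑ P l (z) w ^ l` vanishes at
sufficiently many sums of points must be zero. -/
theorem zero_estimate {F ι : Type*} [Field F] {K L : ℕ} (P : Fin L → F[X])
    (hP : ∀ l, (P l).natDegree ≤ K - 1)
    (z₁ w₁ : Fin L → F) (hw₁ : Function.Injective w₁)
    (E : Finset ι) (z₂ w₂ : ι → F) (hz₂ : Set.InjOn z₂ E) (hw₂ : ∀ j ∈ E, w₂ j ≠ 0)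
    (hE : (K - 1) * L < E.card)
    (hzero : ∀ i, ∀ j ∈ E, ∑ l : Fin L, (P l).eval (z₁ i + z₂ j) * (w₁ i * w₂ j) ^ (l : ℕ) = 0) :
    ∀ l, P l = 0 := by
  classical
  by_contra! hne
  let J := {l : Fin L // P l ≠ 0}
  have hli : LinearIndependent F
      (Matrix.of fun (l : J) (i : Fin L) => w₁ i ^ (l.1 : ℕ)).row := by
    have h1 : LinearIndependent F (Matrix.vandermonde w₁).transpose.row := by
      rw [Matrix.linearIndependent_rows_iff_isUnit, Matrix.isUnit_iff_isUnit_det,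
        Matrix.det_transpose]
      exact (Matrix.det_vandermonde_ne_zero_iff.2 hw₁).isUnit
    exact h1.comp (fun l : J => l.1) Subtype.val_injective
  obtain ⟨f, -, hf⟩ := Matrix.exists_det_submatrix_ne_zero _ hli
  let D : Matrix J J F[X] := Matrix.of fun l i =>
    (P l.1).comp (X + C (z₁ (f i))) * C (w₁ (f i) ^ (l.1 : ℕ))
  have hdeg : ∀ l i, (D l i).natDegree ≤ (P l.1).natDegree := by
    intro l i
    have h2 : ((P l.1).comp (X + C (z₁ (f i)))).natDegree = (P l.1).natDegree := by
      rw [natDegree_comp, natDegree_X_add_C, mul_one]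
    exact (natDegree_mul_C_le _ _).trans h2.le
  have hcoef : ∀ l i, (D l i).coeff (P l.1).natDegree
      = (P l.1).leadingCoeff * w₁ (f i) ^ (l.1 : ℕ) := by
    intro l i
    simp only [D, Matrix.of_apply, coeff_mul_C]
    congr 1
    have h2 : ((P l.1).comp (X + C (z₁ (f i)))).natDegree = (P l.1).natDegree := by
      rw [natDegree_comp, natDegree_X_add_C, mul_one]
    have h3 := leadingCoeff_comp (p := P l.1) (q := X + C (z₁ (f i))) (by simp)
    rw [leadingCoeff, h2] at h3
    rw [h3]; simp
  have hprod : ∀ σ : Equiv.Perm J, (∏ i, D (σ i) i).natDegree ≤ ∑ l : J, (P l.1).natDegree := by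
    intro σ
    refine (natDegree_prod_le _ _).trans ?_
    rw [← Equiv.sum_comp σ (fun l : J => (P l.1).natDegree)]
    exact Finset.sum_le_sum fun i _ => hdeg _ _
  have hcoefdet : D.det.coeff (∑ l : J, (P l.1).natDegree)
      = (∏ l : J, (P l.1).leadingCoeff) *
        (Matrix.det (Matrix.of fun (l i : J) => w₁ (f i) ^ (l.1 : ℕ))) := by
    rw [← Matrix.det_mul_column, Matrix.det_apply, Matrix.det_apply, finsetSum_coeff]
    refine Finset.sum_congr rfl fun σ _ => ?_
    rw [Units.smul_def, Units.smul_def, coeff_smul]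
    congr 1
    rw [← Equiv.sum_comp σ (fun l : J => (P l.1).natDegree),
      coeff_prod_sum_of_natDegree_le _ _ _ (fun i _ => hdeg _ _)]
    exact Finset.prod_congr rfl fun i _ => hcoef _ _
  have hdet : D.det ≠ 0 := by
    intro h0
    rw [h0, coeff_zero] at hcoefdet
    refine mul_ne_zero (Finset.prod_ne_zero_iff.2 fun l _ => ?_) hf hcoefdet.symm
    exact leadingCoeff_ne_zero.2 l.2
  have hdegdet : D.det.natDegree ≤ (K - 1) * L := by
    rw [Matrix.det_apply]
    refine natDegree_sum_le_of_forall_le _ _ fun σ _ => ?_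
    rw [Units.smul_def]
    refine (natDegree_smul_le _ _).trans ((hprod σ).trans ?_)
    calc ∑ l : J, (P l.1).natDegree ≤ ∑ l : J, (K - 1) := Finset.sum_le_sum fun l _ => hP _
      _ = Fintype.card J * (K - 1) := by simp
      _ ≤ L * (K - 1) := by
        gcongr
        exact (Fintype.card_subtype_le (fun l : Fin L => P l ≠ 0)).trans_eq (Fintype.card_fin L)
      _ = _ := mul_comm _ _
  refine hdet (eq_zero_of_natDegree_lt_card_of_eval_eq_zero' _ (E.image z₂) ?_ ?_)
  · intro x hx
    obtain ⟨j, hj, rfl⟩ := Finset.mem_image.1 hx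
    rw [← coe_evalRingHom, RingHom.map_det]
    rw [← Matrix.det_transpose, ← Matrix.exists_mulVec_eq_zero_iff]
    obtain ⟨l₀, hl₀⟩ := hne
    refine ⟨fun l : J => w₂ j ^ (l.1 : ℕ), ?_, ?_⟩
    · intro h
      exact pow_ne_zero _ (hw₂ j hj) (congrFun h ⟨l₀, hl₀⟩)
    · funext i
      rw [Pi.zero_apply, ← hzero (f i) j hj]
      simp only [Matrix.mulVec, dotProduct]
      have hs : ∑ l : Fin L, (P l).eval (z₁ (f i) + z₂ j) * (w₁ (f i) * w₂ j) ^ (l : ℕ)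
          = ∑ l ∈ Finset.univ.filter (fun l => P l ≠ 0),
            (P l).eval (z₁ (f i) + z₂ j) * (w₁ (f i) * w₂ j) ^ (l : ℕ) := by
        rw [Finset.sum_filter]
        refine Finset.sum_congr rfl fun l _ => ?_
        split_ifs with h
        · rfl
        · rw [not_not.1 h]; simp
      rw [hs, ← Finset.sum_subtype_eq_sum_filter]
      simp only [Finset.subtype_univ]
      refine Finset.sum_congr rfl fun l _ => ?_
      simp only [D, Matrix.transpose_apply, RingHom.mapMatrix_apply, Matrix.map_apply,
        Matrix.of_apply, coe_evalRingHom, eval_mul, eval_comp, eval_add, eval_X, eval_C, mul_pow]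
      rw [add_comm (z₂ j)]
      ring
  · rw [Finset.card_image_of_injOn hz₂]
    exact hdegdet.trans_lt hE

/-- Taylor expansion of an entire function at `0` with entire remainder. -/
theorem Differentiable.exists_taylor_remainder {f : ℂ → ℂ} (hf : Differentiable ℂ f) (N : ℕ) :
    ∃ (c : ℕ → ℂ) (h : ℂ → ℂ), Differentiable ℂ h ∧
      ∀ z, f z = ∑ m ∈ Finset.range N, c m * z ^ m + z ^ N * h z := by
  induction N with
  | zero => exact ⟨0, f, hf, by simp⟩
  | succ N ih =>
    obtain ⟨c, h, hh, hfz⟩ := ih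
    refine ⟨Function.update c N (h 0), dslope h 0, ?_, fun z => ?_⟩
    · rw [← differentiableOn_univ] at hh ⊢
      exact (Complex.differentiableOn_dslope Filter.univ_mem).2 hh
    · rw [hfz z, Finset.sum_range_succ, Function.update_self]
      have h1 : ∑ m ∈ Finset.range N, Function.update c N (h 0) m * z ^ m
          = ∑ m ∈ Finset.range N, c m * z ^ m := by
        refine Finset.sum_congr rfl fun m hm => ?_
        rw [Function.update_of_ne (Finset.mem_range.1 hm).ne]
      have h2 : h z = h 0 + z * dslope h 0 z := by
        have := sub_smul_dslope h 0 z
        simp only [sub_zero, smul_eq_mul] at this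
        rw [this]; ring
      rw [h1, h2]; ring

theorem sum_ge_of_injOn_lt {ι : Type*} [Fintype ι] (μ : ι → ℕ)
    (hμ : ∀ i j, i ≠ j → μ i = μ j → Fintype.card ι ≤ μ i) :
    ∑ m ∈ Finset.range (Fintype.card ι), m ≤ ∑ i, μ i := by
  classical
  set N := Fintype.card ι with hN
  have h1 : ∀ i, ((Finset.range N).filter (fun t => t < μ i)).card ≤ μ i := by
    intro i
    calc _ ≤ (Finset.range (μ i)).card := Finset.card_le_card (by
          intro t ht
          simp only [Finset.mem_filter] at ht
          exact Finset.mem_range.2 ht.2)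
      _ = _ := Finset.card_range _
  have h2 : ∀ t ∈ Finset.range N, N - 1 - t ≤ (Finset.univ.filter (fun i => t < μ i)).card := by
    intro t ht
    rw [Finset.mem_range] at ht
    have h3 : (Finset.univ.filter (fun i => ¬ t < μ i)).card ≤ t + 1 := by
      rw [← Finset.card_range (t + 1)]
      refine Finset.card_le_card_of_injOn μ ?_ ?_
      · intro i hi
        simp at hi ⊢; omega
      · intro i hi j hj hij
        by_contra hne
        have := hμ i j hne hij
        simp at hi; omega
    have h4 := Finset.card_filter_add_card_filter_not (s := (Finset.univ : Finset ι))
      (fun i => t < μ i)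
    rw [Finset.card_univ, ← hN] at h4
    omega
  calc ∑ m ∈ Finset.range N, m = ∑ t ∈ Finset.range N, (N - 1 - t) :=
        (Finset.sum_range_reflect (fun m => m) N).symm
    _ ≤ ∑ t ∈ Finset.range N, (Finset.univ.filter (fun i => t < μ i)).card :=
        Finset.sum_le_sum h2
    _ = ∑ i, ((Finset.range N).filter (fun t => t < μ i)).card := by
        simp only [Finset.card_filter]
        exact Finset.sum_comm
    _ ≤ _ := Finset.sum_le_sum fun i _ => h1 i

/-- A determinant whose `i`-th row is `∑ c i m * v j ^ m * z ^ m` up to order `N` vanishes at `0`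
to order at least `0 + 1 + ⋯ + (N - 1)`. -/
theorem Matrix.exists_det_eq_pow_mul {ι : Type*} [Fintype ι] [DecidableEq ι]
    (c : ι → ℕ → ℂ) (v : ι → ℂ) (h : ι → ι → ℂ → ℂ) (hh : ∀ i j, Differentiable ℂ (h i j))
    (M : ℂ → Matrix ι ι ℂ)
    (hM : ∀ z i j, M z i j = ∑ m ∈ Finset.range (Fintype.card ι), c i m * v j ^ m * z ^ m
      + z ^ Fintype.card ι * h i j z) :
    ∃ H : ℂ → ℂ, Differentiable ℂ H ∧
      ∀ z, (M z).det = z ^ (∑ m ∈ Finset.range (Fintype.card ι), m) * H z := by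
  classical
  set N := Fintype.card ι with hN
  set e := ∑ m ∈ Finset.range N, m with he
  let G : (ι → Fin (N + 1)) → ℂ → Matrix ι ι ℂ := fun μ z => Matrix.of fun i j =>
    if (μ i : ℕ) < N then v j ^ (μ i : ℕ) else h i j z
  let k : (ι → Fin (N + 1)) → ι → ℂ := fun μ i => if (μ i : ℕ) < N then c i (μ i) else 1
  refine ⟨fun z => ∑ μ : ι → Fin (N + 1), if (G μ z).det = 0 then 0 else
    (∏ i, k μ i) * z ^ (∑ i, (μ i : ℕ) - e) * (G μ z).det, ?_, ?_⟩
  · have hs : (fun z => ∑ μ : ι → Fin (N + 1), if (G μ z).det = 0 then 0 else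
        (∏ i, k μ i) * z ^ (∑ i, (μ i : ℕ) - e) * (G μ z).det)
        = fun z => ∑ μ : ι → Fin (N + 1),
        (∏ i, k μ i) * z ^ (∑ i, (μ i : ℕ) - e) * (G μ z).det := by
      funext z
      refine Finset.sum_congr rfl fun μ _ => ?_
      split_ifs with h0
      · rw [h0, mul_zero]
      · rfl
    rw [hs]
    refine Differentiable.fun_sum fun μ _ => ?_
    refine Differentiable.mul (by fun_prop) ?_
    simp only [Matrix.det_apply]
    refine Differentiable.fun_sum fun σ _ => ?_
    refine Differentiable.fun_const_smul ?_ _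
    refine Differentiable.fun_finsetProd fun i _ => ?_
    simp only [G, Matrix.of_apply]
    split_ifs
    · fun_prop
    · exact hh _ _
  · intro z
    have hrow : M z = fun i => ∑ m : Fin (N + 1), fun j =>
        if (m : ℕ) < N then c i m * v j ^ (m : ℕ) * z ^ (m : ℕ) else z ^ N * h i j z := by
      funext i j
      rw [hM, Finset.sum_apply, Fin.sum_univ_castSucc, Finset.sum_range]
      simp
    have hexp : (M z).det = ∑ μ : ι → Fin (N + 1), Matrix.det (fun i j =>
        if (μ i : ℕ) < N then c i (μ i) * v j ^ (μ i : ℕ) * z ^ (μ i : ℕ)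
          else z ^ N * h i j z) := by
      rw [hrow]
      exact (Matrix.detRowAlternating (n := ι) (R := ℂ)).toMultilinearMap.map_sum
        (fun i (m : Fin (N + 1)) => fun j =>
        if (m : ℕ) < N then c i m * v j ^ (m : ℕ) * z ^ (m : ℕ) else z ^ N * h i j z)
    rw [hexp, Finset.mul_sum]
    refine Finset.sum_congr rfl fun μ _ => ?_
    have hfac : Matrix.det (fun i j =>
        if (μ i : ℕ) < N then c i (μ i) * v j ^ (μ i : ℕ) * z ^ (μ i : ℕ)
          else z ^ N * h i j z) = (∏ i, k μ i) * z ^ (∑ i, (μ i : ℕ)) * (G μ z).det := by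
      rw [← Finset.prod_pow_eq_pow_sum, ← Finset.prod_mul_distrib, ← Matrix.det_mul_column]
      congr 1
      funext i j
      simp only [Matrix.of_apply, k, G]
      split_ifs with hlt
      · ring
      · have : (μ i : ℕ) = N := by have := (μ i).2; omega
        rw [this]; ring
    rw [hfac]
    split_ifs with h0
    · rw [h0]; simp
    · have hle : e ≤ ∑ i, (μ i : ℕ) := by
        refine sum_ge_of_injOn_lt _ fun i j hij hμ => ?_
        by_contra hlt
        push Not at hlt
        refine h0 (Matrix.det_zero_of_row_eq hij ?_)
        funext l
        have h1 : (μ i : ℕ) < N := hlt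
        have h2 : (μ j : ℕ) < N := hμ ▸ hlt
        simp only [G, Matrix.of_apply, h2, if_true, hμ]
      rw [← Nat.add_sub_cancel' hle, pow_add]
      simp only [Nat.add_sub_cancel_left]
      ring

theorem norm_le_div_pow_of_eq_pow_mul {Ψ H : ℂ → ℂ} (hH : Differentiable ℂ H) {e : ℕ}
    (hΨ : ∀ z, Ψ z = z ^ e * H z) {ρ C : ℝ} (hρ : 1 ≤ ρ) (hC : ∀ z, ‖z‖ = ρ → ‖Ψ z‖ ≤ C) :
    ‖Ψ 1‖ ≤ C / ρ ^ e := by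
  have hρ0 : 0 < ρ := by linarith
  rw [hΨ 1, one_pow, one_mul]
  refine Complex.norm_le_of_forall_mem_frontier_norm_le (U := Metric.ball 0 ρ)
    Metric.isBounded_ball hH.diffContOnCl ?_ ?_
  · intro z hz
    rw [frontier_ball _ hρ0.ne', mem_sphere_zero_iff_norm] at hz
    have h1 := hC z hz
    rw [hΨ, norm_mul, norm_pow, hz] at h1
    rw [le_div_iff₀ (by positivity)]
    linarith
  · rw [closure_ball _ hρ0.ne']
    simpa using hρ

/-- Upper bound for an interpolation determinant in the functions `x ^ k / k! * exp (s * x)`,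
perturbed multiplicatively. -/
theorem interpolation_det_le {K L : ℕ} (lam : Fin L → ℝ) (θ : ℝ) (v : Fin K × Fin L → ℝ)
    (ε : Fin K × Fin L → Fin K × Fin L → ℝ) {ρ V G : ℝ} (hρ : 1 ≤ ρ)
    (hv : ∀ j, |v j| ≤ V) (hε : ∀ i j, |ε i j| * ρ ^ (K * L) ≤ 1)
    (hG : ∀ σ : Equiv.Perm (Fin K × Fin L), |∑ j, lam (σ j).2 * (θ * v j)| ≤ G) :
    |Matrix.det (Matrix.of fun i j : Fin K × Fin L =>
      v j ^ (i.1 : ℕ) / (i.1 : ℕ).factorial * Real.exp (lam i.2 * (θ * v j)) * (1 + ε i j))|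
      ≤ (K * L).factorial * (2 ^ (K * L) * (∏ i : Fin K × Fin L,
        (ρ * V) ^ (i.1 : ℕ) / (i.1 : ℕ).factorial) * Real.exp (ρ * G))
        / ρ ^ (∑ m ∈ Finset.range (K * L), m) := by
  classical
  have hcard : Fintype.card (Fin K × Fin L) = K * L := by simp
  have hρ0 : 0 < ρ := by linarith
  let f : Fin K × Fin L → ℂ → ℂ := fun i x =>
    x ^ (i.1 : ℕ) / (i.1 : ℕ).factorial * Complex.exp ((lam i.2 * θ : ℝ) * x)
  have hf : ∀ i, Differentiable ℂ (f i) := by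
    intro i
    simp only [f]
    fun_prop
  choose c h hh hfz using fun i => (hf i).exists_taylor_remainder (K * L)
  let M : ℂ → Matrix (Fin K × Fin L) (Fin K × Fin L) ℂ := fun z => Matrix.of fun i j =>
    f i (v j * z) * (1 + ε i j * z ^ (K * L))
  obtain ⟨H, hH, hMH⟩ := Matrix.exists_det_eq_pow_mul c (fun j => (v j : ℂ))
    (fun i j z => (v j : ℂ) ^ (K * L) * h i (v j * z) + f i (v j * z) * ε i j)
    (by intro i j
        have h1 := hh i
        have h2 := hf i
        have h3 : Differentiable ℂ fun z => h i (v j * z) := h1.comp (by fun_prop)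
        have h4 : Differentiable ℂ fun z => f i (v j * z) := h2.comp (by fun_prop)
        exact (h3.const_mul _).add (h4.mul_const _)) M
    (by intro z i j
        rw [hcard]
        simp only [M, Matrix.of_apply]
        rw [mul_add, mul_one]
        nth_rewrite 1 [hfz i]
        simp only [mul_pow]
        have : ∀ m, c i m * ((v j : ℂ) ^ m * z ^ m) = c i m * (v j : ℂ) ^ m * z ^ m := by
          intro m; ring
        simp only [this]
        ring)
  rw [hcard] at hMH
  have hone : ((Matrix.det (Matrix.of fun i j : Fin K × Fin L =>
      v j ^ (i.1 : ℕ) / (i.1 : ℕ).factorial * Real.exp (lam i.2 * (θ * v j)) * (1 + ε i j)) : ℝ) : ℂ)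
      = (M 1).det := by
    rw [← Complex.ofRealHom_eq_coe, RingHom.map_det]
    congr 1
    ext i j
    simp only [RingHom.mapMatrix_apply, Matrix.map_apply, Matrix.of_apply, M, f,
      Complex.ofRealHom_eq_coe]
    push_cast
    simp only [mul_one, one_pow, mul_assoc]
  rw [← Real.norm_eq_abs, ← Complex.norm_real, hone]
  refine norm_le_div_pow_of_eq_pow_mul hH hMH hρ fun z hz => ?_
  rw [Matrix.det_apply]
  refine (norm_sum_le _ _).trans ?_
  have hterm : ∀ σ ∈ (Finset.univ : Finset (Equiv.Perm (Fin K × Fin L))),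
      ‖Equiv.Perm.sign σ • ∏ i, M z (σ i) i‖ ≤ 2 ^ (K * L) * (∏ i : Fin K × Fin L,
        (ρ * V) ^ (i.1 : ℕ) / (i.1 : ℕ).factorial) * Real.exp (ρ * G) := by
    intro σ _
    have hsg : ‖Equiv.Perm.sign σ • ∏ i, M z (σ i) i‖ = ‖∏ i, M z (σ i) i‖ := by
      rcases Int.units_eq_one_or (Equiv.Perm.sign σ) with h | h <;> rw [h] <;> simp
    rw [hsg]
    simp only [M, f, Matrix.of_apply]
    rw [Finset.prod_mul_distrib, Finset.prod_mul_distrib, norm_mul, norm_mul,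
      ← Complex.exp_sum, norm_prod, norm_prod]
    have h1 : ∏ j, ‖((v j : ℂ) * z) ^ ((σ j).1 : ℕ) / (((σ j).1 : ℕ).factorial : ℂ)‖
        ≤ ∏ i : Fin K × Fin L, (ρ * V) ^ (i.1 : ℕ) / (i.1 : ℕ).factorial := by
      rw [← Equiv.prod_comp σ (fun i : Fin K × Fin L => (ρ * V) ^ (i.1 : ℕ)
        / ((i.1 : ℕ).factorial : ℝ))]
      refine Finset.prod_le_prod (fun _ _ => norm_nonneg _) fun j _ => ?_
      rw [norm_div, norm_pow, norm_mul, hz, Complex.norm_real, Complex.norm_natCast, mul_comm,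
        Real.norm_eq_abs]
      gcongr
      exact hv j
    have h2 : ∏ j, ‖(1 : ℂ) + ε (σ j) j * z ^ (K * L)‖ ≤ 2 ^ (K * L) := by
      calc _ ≤ ∏ j : Fin K × Fin L, (2 : ℝ) := by
            refine Finset.prod_le_prod (fun _ _ => norm_nonneg _) fun j _ => ?_
            refine (norm_add_le _ _).trans ?_
            rw [norm_one, norm_mul, norm_pow, hz, Complex.norm_real, Real.norm_eq_abs]
            linarith [hε (σ j) j]
        _ = _ := by simp
    have h3 : ‖Complex.exp (∑ j, ((lam (σ j).2 * θ : ℝ) : ℂ) * (v j * z))‖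
        ≤ Real.exp (ρ * G) := by
      rw [Complex.norm_exp]
      refine Real.exp_le_exp.2 ?_
      have h4 : ∑ j, ((lam (σ j).2 * θ : ℝ) : ℂ) * (v j * z)
          = ((∑ j, lam (σ j).2 * (θ * v j) : ℝ) : ℂ) * z := by
        push_cast
        rw [Finset.sum_mul]
        exact Finset.sum_congr rfl fun j _ => by ring
      refine (Complex.re_le_norm _).trans ?_
      rw [h4, norm_mul, hz, Complex.norm_real, Real.norm_eq_abs, mul_comm]
      exact mul_le_mul_of_nonneg_left (hG σ) hρ0.le
    have hp0 : 0 ≤ ∏ i : Fin K × Fin L, (ρ * V) ^ (i.1 : ℕ) / ((i.1 : ℕ).factorial : ℝ) :=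
      le_trans (Finset.prod_nonneg fun _ _ => norm_nonneg _) h1
    calc _ ≤ ((∏ i : Fin K × Fin L, (ρ * V) ^ (i.1 : ℕ) / (i.1 : ℕ).factorial)
          * Real.exp (ρ * G)) * 2 ^ (K * L) := by
          gcongr
      _ = _ := by ring
  refine (Finset.sum_le_sum hterm).trans_eq ?_
  rw [Finset.sum_const, Finset.card_univ, Fintype.card_perm, hcard, nsmul_eq_mul]

open Polynomial in
theorem det_eval_mul_eq {K L : ℕ} (p : Fin K → ℝ[X]) (hp : ∀ k, (p k).natDegree ≤ k)
    (z : Fin K × Fin L → ℝ) (W : Fin L → Fin K × Fin L → ℝ) :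
    Matrix.det (Matrix.of fun i j : Fin K × Fin L => (p i.1).eval (z j) * W i.2 j)
      = (∏ k, (p k).coeff k) ^ L *
        Matrix.det (Matrix.of fun i j : Fin K × Fin L => z j ^ (i.1 : ℕ) * W i.2 j) := by
  let T : Matrix (Fin K) (Fin K) ℝ := Matrix.of fun k m => (p k).coeff m
  have hT : T.det = ∏ k, (p k).coeff k := by
    rw [Matrix.det_of_isLowerTriangular]
    · rfl
    · intro i j hij
      exact coeff_eq_zero_of_natDegree_lt ((hp i).trans_lt hij)
  have hdet : (Matrix.kroneckerMap (fun x y => x * y) T (1 : Matrix (Fin L) (Fin L) ℝ)).det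
      = (∏ k, (p k).coeff k) ^ L := by
    rw [Matrix.det_kronecker, hT]; simp
  rw [← hdet, ← Matrix.det_mul]
  congr 1
  ext i j
  rw [Matrix.mul_apply, Fintype.sum_prod_type]
  simp only [Matrix.of_apply, Matrix.kroneckerMap_apply, Matrix.one_apply, T]
  have hs : ∀ x : Fin K, ∑ y : Fin L, (p i.1).coeff x * (if i.2 = y then 1 else 0)
      * (z j ^ (x : ℕ) * W y j) = (p i.1).coeff x * z j ^ (x : ℕ) * W i.2 j := by
    intro x
    rw [Finset.sum_eq_single i.2]
    · simp; ring
    · intro y _ hy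
      simp [hy.symm]
    · simp
  simp only [hs]
  rw [← Finset.sum_mul, eval_eq_sum_range' (n := K) ((hp i.1).trans_lt i.1.2), Finset.sum_range]

/-- If a determinant of integers is nonzero and every term of its Leibniz expansion is divisible
by `a ^ m * b ^ m'`, its absolute value is at least `a ^ m * b ^ m'`. -/
theorem pow_mul_pow_le_abs_det {ι : Type*} [Fintype ι] [DecidableEq ι] (a b : ℕ)
    (C e f : ι → ι → ℕ) {m m' : ℕ} (hm : ∀ σ : Equiv.Perm ι, m ≤ ∑ j, e (σ j) j)
    (hm' : ∀ σ : Equiv.Perm ι, m' ≤ ∑ j, f (σ j) j)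
    (hne : Matrix.det (Matrix.of fun i j => (C i j : ℝ) * (a ^ e i j * b ^ f i j)) ≠ 0) :
    (a : ℝ) ^ m * b ^ m' ≤
      |Matrix.det (Matrix.of fun i j => (C i j : ℝ) * (a ^ e i j * b ^ f i j))| := by
  set D : ℤ := Matrix.det (Matrix.of fun i j => (C i j : ℤ) * (a ^ e i j * b ^ f i j)) with hD
  have hcast : Matrix.det (Matrix.of fun i j => (C i j : ℝ) * (a ^ e i j * b ^ f i j)) = D := by
    have h := RingHom.map_det (Int.castRingHom ℝ)
      (Matrix.of fun i j => (C i j : ℤ) * ((a : ℤ) ^ e i j * (b : ℤ) ^ f i j))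
    rw [← hD, eq_intCast] at h
    rw [h]
    congr 1
    ext i j
    simp
  rw [hcast] at hne ⊢
  have hdvd : ((a : ℤ) ^ m * b ^ m') ∣ D := by
    rw [hD, Matrix.det_apply]
    refine Finset.dvd_sum fun σ _ => ?_
    rw [Units.smul_def, zsmul_eq_mul]
    refine Dvd.dvd.mul_left ?_ _
    simp only [Matrix.of_apply]
    rw [Finset.prod_mul_distrib, Finset.prod_mul_distrib, Finset.prod_pow_eq_pow_sum,
      Finset.prod_pow_eq_pow_sum]
    exact Dvd.dvd.mul_left (mul_dvd_mul (pow_dvd_pow _ (hm σ)) (pow_dvd_pow _ (hm' σ))) _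
  have := Int.le_of_dvd (abs_pos.2 (by exact_mod_cast hne)) ((dvd_abs _ _).2 hdvd)
  exact_mod_cast this

theorem sum_sq_sub_le (n : ℕ) :
    ∑ l : Fin n, ((l : ℝ) - ((n : ℝ) - 1) / 2) ^ 2 ≤ (n : ℝ) ^ 3 / 12 := by
  have h : ∀ (c : ℝ) (n : ℕ), ∑ l ∈ Finset.range n, ((l : ℝ) - c) ^ 2
      = n * (n - 1) * (2 * n - 1) / 6 - c * n * (n - 1) + n * c ^ 2 := by
    intro c n
    induction n with
    | zero => simp
    | succ n ih => rw [Finset.sum_range_succ, ih]; push_cast; ring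
  rw [← Finset.sum_range (fun l : ℕ => ((l : ℝ) - ((n : ℝ) - 1) / 2) ^ 2), h]
  have : (0 : ℝ) ≤ n := n.cast_nonneg
  nlinarith

/-- Bound for the correlation of two centred integer sequences attached to lattice points. -/
theorem abs_sum_centred_le {K L R S : ℕ} {f g : Fin K × Fin L → ℕ}
    (hf : ∀ j, f j < R) (hg : ∀ j, g j < S) (hinj : ∀ i j, f i = f j → g i = g j → i = j)
    (σ : Equiv.Perm (Fin K × Fin L)) :
    |∑ j, (((σ j).2 : ℝ) - ((L : ℝ) - 1) / 2) * ((f j : ℝ) - ((R : ℝ) - 1) / 2)|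
      ≤ L * R / 12 * √(K * L * (R * S)) := by
  have hcs := Finset.sum_mul_sq_le_sq_mul_sq Finset.univ
    (fun j => ((σ j).2 : ℝ) - ((L : ℝ) - 1) / 2) (fun j => (f j : ℝ) - ((R : ℝ) - 1) / 2)
  have h1 : ∑ j, (((σ j).2 : ℝ) - ((L : ℝ) - 1) / 2) ^ 2 ≤ K * ((L : ℝ) ^ 3 / 12) := by
    rw [Equiv.sum_comp σ (fun i : Fin K × Fin L => ((i.2 : ℝ) - ((L : ℝ) - 1) / 2) ^ 2),
      Fintype.sum_prod_type]
    simp only [Finset.sum_const, Finset.card_univ, Fintype.card_fin, nsmul_eq_mul]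
    gcongr
    exact sum_sq_sub_le L
  have h2 : ∑ j, ((f j : ℝ) - ((R : ℝ) - 1) / 2) ^ 2 ≤ S * ((R : ℝ) ^ 3 / 12) := by
    let q : Fin K × Fin L → Fin S × Fin R := fun j => (⟨g j, hg j⟩, ⟨f j, hf j⟩)
    have hq : Function.Injective q := by
      intro i j hij
      simp only [q, Prod.mk.injEq, Fin.mk.injEq] at hij
      exact hinj i j hij.2 hij.1
    calc _ = ∑ p ∈ Finset.univ.map ⟨q, hq⟩, ((p.2 : ℝ) - ((R : ℝ) - 1) / 2) ^ 2 := by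
          rw [Finset.sum_map]; rfl
      _ ≤ ∑ p : Fin S × Fin R, ((p.2 : ℝ) - ((R : ℝ) - 1) / 2) ^ 2 :=
          Finset.sum_le_sum_of_subset_of_nonneg (Finset.subset_univ _) fun _ _ _ => sq_nonneg _
      _ = S * ∑ r : Fin R, ((r : ℝ) - ((R : ℝ) - 1) / 2) ^ 2 := by
          rw [Fintype.sum_prod_type]
          simp only [Finset.sum_const, Finset.card_univ, Fintype.card_fin, nsmul_eq_mul]
      _ ≤ _ := by
          gcongr
          exact sum_sq_sub_le R
  refine abs_le_of_sq_le_sq (hcs.trans ?_) (by positivity)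
  rw [mul_pow, Real.sq_sqrt (by positivity)]
  calc _ ≤ (K * ((L : ℝ) ^ 3 / 12)) * (S * ((R : ℝ) ^ 3 / 12)) := by
        gcongr
    _ = _ := by ring

open Polynomial in
/-- Existence of lattice points at which the interpolation determinant does not vanish. -/
theorem exists_interpolation_det_ne_zero {a b X Y K L R₁ S₁ R₂ S₂ R S : ℕ}
    (ha : 0 < a) (hb : 0 < b) (hL : L ≤ R₁ * S₁) (hKL : (K - 1) * L < R₂ * S₂)
    (hR : R₁ + R₂ ≤ R + 1) (hS : S₁ + S₂ ≤ S + 1)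
    (hab : ∀ r s r' s' : ℕ, a ^ r * b ^ s = a ^ r' * b ^ s' → r = r' ∧ s = s')
    (hXY : ∀ r s r' s' : ℕ, r < R₂ → s < S₂ → r' < R₂ → s' < S₂ →
      r * Y + s * X = r' * Y + s' * X → r = r' ∧ s = s') :
    ∃ f g : Fin K × Fin L → ℕ, (∀ j, f j < R) ∧ (∀ j, g j < S) ∧
      (∀ i j, f i = f j → g i = g j → i = j) ∧
      Matrix.det (Matrix.of fun i j : Fin K × Fin L =>
        ((f j * Y + g j * X : ℕ) : ℝ) ^ (i.1 : ℕ)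
          * ((a : ℝ) ^ ((i.2 : ℕ) * f j) * (b : ℝ) ^ ((i.2 : ℕ) * g j))) ≠ 0 := by
  classical
  let M : Matrix (Fin K × Fin L) (Fin R × Fin S) ℝ := Matrix.of fun i j =>
    ((j.1 * Y + j.2 * X : ℕ) : ℝ) ^ (i.1 : ℕ)
      * ((a : ℝ) ^ ((i.2 : ℕ) * j.1) * (b : ℝ) ^ ((i.2 : ℕ) * j.2))
  have hli : LinearIndependent ℝ M.row := by
    rw [Fintype.linearIndependent_iff]
    intro c hc
    let P : Fin L → ℝ[X] := fun l => ∑ k : Fin K, C (c (k, l)) * Polynomial.X ^ (k : ℕ)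
    have hP : ∀ l, (P l).natDegree ≤ K - 1 := by
      intro l
      refine natDegree_sum_le_of_forall_le _ _ fun k _ => ?_
      refine (natDegree_C_mul_X_pow_le _ _).trans ?_
      have := k.2; omega
    have hcoef : ∀ l (k : Fin K), (P l).coeff k = c (k, l) := by
      intro l k
      simp only [P, finsetSum_coeff, coeff_C_mul, coeff_X_pow]
      rw [Finset.sum_eq_single k]
      · simp
      · intro k' _ hk'
        have : (k : ℕ) ≠ k' := fun h => hk' (Fin.ext h.symm)
        simp [this]
      · simp
    have hcard : Fintype.card (Fin L) ≤ Fintype.card (Fin R₁ × Fin S₁) := by simpa using hL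
    obtain ⟨φ⟩ := Function.Embedding.nonempty_of_card_le hcard
    have hzero := zero_estimate (K := K) P hP
      (fun i => (((φ i).1 * Y + (φ i).2 * X : ℕ) : ℝ))
      (fun i => ((a ^ ((φ i).1 : ℕ) * b ^ ((φ i).2 : ℕ) : ℕ) : ℝ))
      (by
        intro i j hij
        have h1 : a ^ ((φ i).1 : ℕ) * b ^ ((φ i).2 : ℕ) = a ^ ((φ j).1 : ℕ) * b ^ ((φ j).2 : ℕ) := by
          beta_reduce at hij
          exact_mod_cast hij
        have h2 := hab _ _ _ _ h1
        exact φ.injective (Prod.ext (Fin.ext h2.1) (Fin.ext h2.2)))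
      (Finset.univ : Finset (Fin R₂ × Fin S₂))
      (fun j => ((j.1 * Y + j.2 * X : ℕ) : ℝ))
      (fun j => ((a ^ (j.1 : ℕ) * b ^ (j.2 : ℕ) : ℕ) : ℝ))
      (by
        intro i _ j _ hij
        have h1 : (i.1 : ℕ) * Y + i.2 * X = j.1 * Y + j.2 * X := by
          beta_reduce at hij
          exact_mod_cast hij
        have h2 := hXY _ _ _ _ i.1.2 i.2.2 j.1.2 j.2.2 h1
        exact Prod.ext (Fin.ext h2.1) (Fin.ext h2.2))
      (by intro j _; positivity)
      (by simpa using hKL)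
      (by
        intro i j _
        have hr : ((φ i).1 : ℕ) + j.1 < R := by have := (φ i).1.2; have := j.1.2; omega
        have hs : ((φ i).2 : ℕ) + j.2 < S := by have := (φ i).2.2; have := j.2.2; omega
        have h1 := congrFun hc (⟨(φ i).1 + j.1, hr⟩, ⟨(φ i).2 + j.2, hs⟩)
        rw [Finset.sum_apply, Fintype.sum_prod_type, Finset.sum_comm] at h1
        rw [Pi.zero_apply] at h1
        rw [← h1]
        refine Finset.sum_congr rfl fun l _ => ?_
        simp only [P, eval_finsetSum, eval_mul, eval_C, eval_pow, eval_X]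
        rw [Finset.sum_mul]
        refine Finset.sum_congr rfl fun k _ => ?_
        simp only [Pi.smul_apply, smul_eq_mul, Matrix.row, M, Matrix.of_apply]
        push_cast
        simp only [mul_pow, ← pow_mul, mul_comm (l : ℕ)]
        ring)
    intro i
    rw [show i = (i.1, i.2) from rfl, ← hcoef, hzero, coeff_zero]
  obtain ⟨q, hq, hdet⟩ := M.exists_det_submatrix_ne_zero hli
  refine ⟨fun j => (q j).1, fun j => (q j).2, fun j => (q j).1.2, fun j => (q j).2.2, ?_, hdet⟩
  intro i j h1 h2
  exact hq (Prod.ext (Fin.ext h1) (Fin.ext h2))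

theorem sum_centred_eq {K L : ℕ} (f : Fin K × Fin L → ℕ) (σ : Equiv.Perm (Fin K × Fin L))
    (c d : ℝ) :
    ∑ j, (((σ j).2 : ℝ) - c) * ((f j : ℝ) - d)
      = ((∑ j, ((σ j).2 : ℕ) * f j : ℕ) : ℝ) - d * ∑ i : Fin K × Fin L, (i.2 : ℝ)
        - c * ∑ j, ((f j : ℝ) - d) := by
  rw [← Equiv.sum_comp σ (fun i : Fin K × Fin L => (i.2 : ℝ))]
  push_cast
  rw [Finset.mul_sum, Finset.mul_sum, ← Finset.sum_sub_distrib, ← Finset.sum_sub_distrib]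
  refine Finset.sum_congr rfl fun j _ => ?_
  ring

open Polynomial in
/-- The determinant of the divided powers is independent of the centre, and agrees with the one
built from binomial coefficients. -/
theorem det_sub_pow_div_factorial_eq {K L : ℕ} (n : Fin K × Fin L → ℕ) (c : ℝ)
    (W : Fin L → Fin K × Fin L → ℝ) :
    Matrix.det (Matrix.of fun i j : Fin K × Fin L =>
        ((n j : ℝ) - c) ^ (i.1 : ℕ) / (i.1 : ℕ).factorial * W i.2 j)
      = Matrix.det (Matrix.of fun i j : Fin K × Fin L =>
        ((n j).choose i.1 : ℝ) * W i.2 j) := by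
  have h1 := det_eval_mul_eq (K := K) (L := L)
    (fun k => C (((k : ℕ).factorial : ℝ)⁻¹) * (X - C c) ^ (k : ℕ))
    (fun k => by compute_degree) (fun j => (n j : ℝ)) W
  have h2 := det_eval_mul_eq (K := K) (L := L)
    (fun k => C (((k : ℕ).factorial : ℝ)⁻¹) * descPochhammer ℝ k)
    (fun k => (natDegree_C_mul_le _ _).trans (descPochhammer_natDegree ℝ k).le)
    (fun j => (n j : ℝ)) W
  have h3 : ∀ k : Fin K, (C (((k : ℕ).factorial : ℝ)⁻¹) * (X - C c) ^ (k : ℕ)).coeff k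
      = (C (((k : ℕ).factorial : ℝ)⁻¹) * descPochhammer ℝ k).coeff k := by
    intro k
    rw [coeff_C_mul, coeff_C_mul]
    congr 1
    have e1 := (monic_X_sub_C c).pow (k : ℕ)
    have e2 := monic_descPochhammer ℝ k
    have d1 : ((X - C c) ^ (k : ℕ)).natDegree = (k : ℕ) := by
      rw [(monic_X_sub_C c).natDegree_pow, natDegree_X_sub_C, mul_one]
    rw [Monic, leadingCoeff, d1] at e1
    rw [Monic, leadingCoeff, descPochhammer_natDegree] at e2
    rw [e1, e2]
  simp only [h3] at h1
  rw [← h2] at h1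
  refine Eq.trans ?_ (h1.trans ?_)
  · congr 1
    ext i j
    simp only [Matrix.of_apply, eval_mul, eval_C, eval_pow, eval_sub, eval_X]
    ring
  · congr 1
    ext i j
    simp only [Matrix.of_apply, eval_mul, eval_C, descPochhammer_eval_eq_descFactorial,
      Nat.descFactorial_eq_factorial_mul_choose]
    have : ((i.1 : ℕ).factorial : ℝ) ≠ 0 := by positivity
    push_cast
    field_simp

theorem exists_forall_sum_mul_le {K L : ℕ} (f : Fin K × Fin L → ℕ) :
    ∃ σ : Equiv.Perm (Fin K × Fin L), ∀ τ : Equiv.Perm (Fin K × Fin L),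
      ∑ j, ((σ j).2 : ℕ) * f j ≤ ∑ j, ((τ j).2 : ℕ) * f j := by
  obtain ⟨σ, -, h⟩ := Finset.exists_min_image Finset.univ
    (fun σ : Equiv.Perm (Fin K × Fin L) => ∑ j, ((σ j).2 : ℕ) * f j) ⟨1, Finset.mem_univ _⟩
  exact ⟨σ, fun τ => h τ (Finset.mem_univ _)⟩

open Polynomial in
/-- Lower bound for the interpolation determinant after centring and scaling. -/
theorem exp_neg_le_abs_det_centred {a b K L R S : ℕ} (ha : 0 < a) (hb : 0 < b)
    {f g : Fin K × Fin L → ℕ} (hf : ∀ j, f j < R) (hg : ∀ j, g j < S)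
    (hinj : ∀ i j, f i = f j → g i = g j → i = j) (n : Fin K × Fin L → ℕ) (c : ℝ)
    (hne : Matrix.det (Matrix.of fun i j : Fin K × Fin L => (n j : ℝ) ^ (i.1 : ℕ)
      * ((a : ℝ) ^ ((i.2 : ℕ) * f j) * (b : ℝ) ^ ((i.2 : ℕ) * g j))) ≠ 0)
    (hA : 0 ≤ Real.log a) (hB : 0 ≤ Real.log b) :
    Real.exp (-(Real.log a * (L * R / 12 * √(K * L * (R * S)))
        + Real.log b * (L * S / 12 * √(K * L * (R * S))))) ≤
      |Matrix.det (Matrix.of fun i j : Fin K × Fin L =>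
        ((n j : ℝ) - c) ^ (i.1 : ℕ) / (i.1 : ℕ).factorial
          * Real.exp (((i.2 : ℝ) - ((L : ℝ) - 1) / 2)
            * (Real.log a * ((f j : ℝ) - ((R : ℝ) - 1) / 2)
              + Real.log b * ((g j : ℝ) - ((S : ℝ) - 1) / 2))))| := by
  set A := Real.log a with hAdef
  set B := Real.log b with hBdef
  set r0 := ((R : ℝ) - 1) / 2 with hr0
  set s0 := ((S : ℝ) - 1) / 2 with hs0
  set l0 := ((L : ℝ) - 1) / 2 with hl0
  let W : Fin L → Fin K × Fin L → ℝ := fun l j =>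
    (a : ℝ) ^ ((l : ℕ) * f j) * (b : ℝ) ^ ((l : ℕ) * g j)
  have hexpA : Real.exp A = a := Real.exp_log (by exact_mod_cast ha)
  have hexpB : Real.exp B = b := Real.exp_log (by exact_mod_cast hb)
  have hW : ∀ l j, W l j = Real.exp (l * f j * A + l * g j * B) := by
    intro l j
    simp only [W]
    rw [← hexpA, ← hexpB, ← Real.exp_nat_mul, ← Real.exp_nat_mul, ← Real.exp_add]
    push_cast
    rfl
  set Dc := Matrix.det (Matrix.of fun i j : Fin K × Fin L =>
        ((n j : ℝ) - c) ^ (i.1 : ℕ) / (i.1 : ℕ).factorial * W i.2 j) with hDc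
  have hDint := det_sub_pow_div_factorial_eq n c W
  have hDc0 : Dc ≠ 0 := by
    have h1 := det_eval_mul_eq (K := K) (L := L)
      (fun k => C (((k : ℕ).factorial : ℝ)⁻¹) * (X - C c) ^ (k : ℕ))
      (fun k => by compute_degree) (fun j => (n j : ℝ)) W
    have h2 : Dc = Matrix.det (Matrix.of fun i j : Fin K × Fin L =>
        (C (((i.1 : ℕ).factorial : ℝ)⁻¹) * (X - C c) ^ (i.1 : ℕ)).eval (n j : ℝ) * W i.2 j) := by
      rw [hDc]
      congr 1
      ext i j
      simp only [Matrix.of_apply, eval_mul, eval_C, eval_pow, eval_sub, eval_X]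
      ring
    rw [h2, h1]
    refine mul_ne_zero (pow_ne_zero _ (Finset.prod_ne_zero_iff.2 fun k _ => ?_)) hne
    rw [coeff_C_mul]
    have e1 := (monic_X_sub_C c).pow (k : ℕ)
    have d1 : ((X - C c) ^ (k : ℕ)).natDegree = (k : ℕ) := by
      rw [(monic_X_sub_C c).natDegree_pow, natDegree_X_sub_C, mul_one]
    rw [Monic, leadingCoeff, d1] at e1
    rw [e1, mul_one]
    positivity
  obtain ⟨σa, hσa⟩ := exists_forall_sum_mul_le f
  obtain ⟨σb, hσb⟩ := exists_forall_sum_mul_le g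
  have hlow : (a : ℝ) ^ (∑ j, ((σa j).2 : ℕ) * f j) * (b : ℝ) ^ (∑ j, ((σb j).2 : ℕ) * g j)
      ≤ |Dc| := by
    have := pow_mul_pow_le_abs_det a b (fun i j : Fin K × Fin L => (n j).choose i.1)
      (fun i j => (i.2 : ℕ) * f j) (fun i j => (i.2 : ℕ) * g j) hσa hσb (hDint ▸ hDc0)
    exact this.trans (le_of_eq (congrArg _ hDint.symm))
  rw [← hexpA, ← hexpB, ← Real.exp_nat_mul, ← Real.exp_nat_mul, ← Real.exp_add] at hlow
  have hscale : Matrix.det (Matrix.of fun i j : Fin K × Fin L =>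
        ((n j : ℝ) - c) ^ (i.1 : ℕ) / (i.1 : ℕ).factorial
          * Real.exp (((i.2 : ℝ) - l0) * (A * ((f j : ℝ) - r0) + B * ((g j : ℝ) - s0))))
      = (∏ j : Fin K × Fin L, Real.exp (-l0 * (A * ((f j : ℝ) - r0) + B * ((g j : ℝ) - s0)))) *
        ((∏ i : Fin K × Fin L, Real.exp (-(i.2 : ℝ) * (A * r0 + B * s0))) * Dc) := by
    rw [hDc, ← Matrix.det_mul_column, ← Matrix.det_mul_row]
    congr 1
    ext i j
    simp only [Matrix.of_apply, hW]
    rw [show ((i.2 : ℝ) - l0) * (A * ((f j : ℝ) - r0) + B * ((g j : ℝ) - s0))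
      = (-l0 * (A * ((f j : ℝ) - r0) + B * ((g j : ℝ) - s0))) + (-(i.2 : ℝ) * (A * r0 + B * s0)
        + (i.2 * f j * A + i.2 * g j * B)) by ring, Real.exp_add, Real.exp_add]
    ring
  rw [hscale, abs_mul, abs_mul, ← Real.exp_sum, ← Real.exp_sum, Real.abs_exp, Real.abs_exp]
  have hca := abs_le.1 (abs_sum_centred_le hf hg hinj σa)
  have hcb := abs_le.1 (abs_sum_centred_le hg hf (fun i j h h' => hinj i j h' h) σb)
  rw [sum_centred_eq, ← hr0, ← hl0] at hca
  rw [sum_centred_eq, ← hs0, ← hl0] at hcb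
  rw [mul_comm (S : ℝ) (R : ℝ)] at hcb
  calc _ ≤ Real.exp (∑ j, -l0 * (A * ((f j : ℝ) - r0) + B * ((g j : ℝ) - s0))) *
        (Real.exp (∑ i : Fin K × Fin L, -(i.2 : ℝ) * (A * r0 + B * s0)) *
          Real.exp (((∑ j, ((σa j).2 : ℕ) * f j : ℕ) : ℝ) * A
            + ((∑ j, ((σb j).2 : ℕ) * g j : ℕ) : ℝ) * B)) := by
        rw [← Real.exp_add, ← Real.exp_add, Real.exp_le_exp]
        have e1 : ∑ j, -l0 * (A * ((f j : ℝ) - r0) + B * ((g j : ℝ) - s0))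
            = -l0 * (A * ∑ j, ((f j : ℝ) - r0) + B * ∑ j, ((g j : ℝ) - s0)) := by
          rw [← Finset.mul_sum, Finset.sum_add_distrib, Finset.mul_sum, Finset.mul_sum]
        have e2 : ∑ i : Fin K × Fin L, -(i.2 : ℝ) * (A * r0 + B * s0)
            = -(∑ i : Fin K × Fin L, (i.2 : ℝ)) * (A * r0 + B * s0) := by
          rw [← Finset.sum_mul, Finset.sum_neg_distrib]
        rw [e1, e2]
        have ha' := mul_le_mul_of_nonneg_left hca.1 hA
        have hb' := mul_le_mul_of_nonneg_left hcb.1 hB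
        linarith
    _ ≤ _ := by gcongr

theorem interpolation_inequality {a b X Y K L R₁ S₁ R₂ S₂ R S : ℕ} (ha : 1 < a) (hb : 1 < b)
    (hY : 0 < Y) (hL : L ≤ R₁ * S₁) (hKL : (K - 1) * L < R₂ * S₂)
    (hR : R₁ + R₂ ≤ R + 1) (hS : S₁ + S₂ ≤ S + 1)
    (hab : ∀ r s r' s' : ℕ, a ^ r * b ^ s = a ^ r' * b ^ s' → r = r' ∧ s = s')
    (hXY : ∀ r s r' s' : ℕ, r < R₂ → s < S₂ → r' < R₂ → s' < S₂ →
      r * Y + s * X = r' * Y + s' * X → r = r' ∧ s = s')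
    {ρ : ℝ} (hρ : 1 ≤ ρ)
    (hΛ : (L : ℝ) * S * |X * Real.log a - Y * Real.log b| / Y * ρ ^ (K * L) ≤ 1) :
    Real.exp (-(Real.log a * (L * R / 12 * √(K * L * (R * S)))
        + Real.log b * (L * S / 12 * √(K * L * (R * S))))) ≤
      (K * L).factorial * (2 ^ (K * L) * (∏ i : Fin K × Fin L,
        (ρ * (((Y : ℝ) * R + X * S) / 2)) ^ (i.1 : ℕ) / (i.1 : ℕ).factorial)
        * Real.exp (ρ * (Real.log a * (L * R / 12 * √(K * L * (R * S)))
          + Real.log a * X / Y * (L * S / 12 * √(K * L * (R * S))))))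
        / ρ ^ (∑ m ∈ Finset.range (K * L), m) := by
  obtain ⟨f, g, hf, hg, hinj, hne⟩ :=
    exists_interpolation_det_ne_zero (K := K) (by omega) (by omega) hL hKL hR hS hab hXY
  have hA : 0 < Real.log a := Real.log_pos (by exact_mod_cast ha)
  have hB : 0 < Real.log b := Real.log_pos (by exact_mod_cast hb)
  have hY' : (0 : ℝ) < Y := by exact_mod_cast hY
  have hlow := exp_neg_le_abs_det_centred (by omega) (by omega) hf hg hinj
    (fun j => f j * Y + g j * X) (Y * (((R : ℝ) - 1) / 2) + X * (((S : ℝ) - 1) / 2)) hne hA.le hB.le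
  refine hlow.trans ?_
  set A := Real.log a with hAdef
  set B := Real.log b with hBdef
  set r0 := ((R : ℝ) - 1) / 2 with hr0
  set s0 := ((S : ℝ) - 1) / 2 with hs0
  set l0 := ((L : ℝ) - 1) / 2 with hl0
  set Λ := X * A - Y * B with hΛdef
  have hfr : ∀ j, |(f j : ℝ) - r0| ≤ R / 2 := by
    intro j
    have h1 : (f j : ℝ) + 1 ≤ R := by exact_mod_cast hf j
    have h2 : (0 : ℝ) ≤ f j := Nat.cast_nonneg _
    rw [abs_le, hr0]; constructor <;> linarith
  have hgs : ∀ j, |(g j : ℝ) - s0| ≤ S / 2 := by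
    intro j
    have h1 : (g j : ℝ) + 1 ≤ S := by exact_mod_cast hg j
    have h2 : (0 : ℝ) ≤ g j := Nat.cast_nonneg _
    rw [abs_le, hs0]; constructor <;> linarith
  have hll : ∀ l : Fin L, |(l : ℝ) - l0| ≤ L / 2 := by
    intro l
    have h1 : (l : ℝ) + 1 ≤ L := by exact_mod_cast l.2
    have h2 : (0 : ℝ) ≤ (l : ℕ) := Nat.cast_nonneg _
    rw [abs_le, hl0]; constructor <;> linarith
  let v : Fin K × Fin L → ℝ := fun j => Y * ((f j : ℝ) - r0) + X * ((g j : ℝ) - s0)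
  let x : Fin K × Fin L → Fin K × Fin L → ℝ := fun i j =>
    -((i.2 : ℝ) - l0) * ((g j : ℝ) - s0) * Λ / Y
  have hX' : (0 : ℝ) ≤ X := Nat.cast_nonneg _
  have hS' : (0 : ℝ) ≤ S := Nat.cast_nonneg _
  have hL' : (0 : ℝ) ≤ L := Nat.cast_nonneg _
  have hpow : 1 ≤ ρ ^ (K * L) := one_le_pow₀ hρ
  have hx : ∀ i j, |x i j| ≤ L * S * |Λ| / Y / 4 := by
    intro i j
    simp only [x]
    rw [abs_div, abs_mul, abs_mul, abs_neg, abs_of_pos hY']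
    calc _ ≤ (L / 2 : ℝ) * (S / 2) * |Λ| / Y := by
          gcongr
          · exact hll _
          · exact hgs _
      _ = _ := by ring
  have hsmall : (L : ℝ) * S * |Λ| / Y ≤ 1 :=
    (le_mul_of_one_le_right (by positivity) hpow).trans hΛ
  have hmat : (Matrix.of fun i j : Fin K × Fin L =>
        (((f j * Y + g j * X : ℕ) : ℝ) - (Y * r0 + X * s0)) ^ (i.1 : ℕ) / (i.1 : ℕ).factorial
          * Real.exp (((i.2 : ℝ) - l0) * (A * ((f j : ℝ) - r0) + B * ((g j : ℝ) - s0))))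
      = (Matrix.of fun i j => v j ^ (i.1 : ℕ) / (i.1 : ℕ).factorial
        * Real.exp (((i.2 : ℝ) - l0) * (A / Y * v j)) * (1 + (Real.exp (x i j) - 1))) := by
    ext i j
    simp only [Matrix.of_apply, v, x]
    rw [add_sub_cancel, mul_assoc, ← Real.exp_add]
    congr 2
    · push_cast; ring
    · rw [hΛdef]; field_simp; ring
  rw [hmat]
  refine interpolation_det_le (fun l => (l : ℝ) - l0) (A / Y) v (fun i j => Real.exp (x i j) - 1)
    hρ ?_ ?_ ?_
  · intro j
    simp only [v]
    refine (abs_add_le _ _).trans ?_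
    rw [abs_mul, abs_mul, abs_of_pos hY', abs_of_nonneg hX']
    have h1 := mul_le_mul_of_nonneg_left (hfr j) hY'.le
    have h2 := mul_le_mul_of_nonneg_left (hgs j) hX'
    linarith
  · intro i j
    have h1 := Real.abs_exp_sub_one_le (x := x i j) ((hx i j).trans (by linarith))
    calc _ ≤ (L * S * |Λ| / Y) * ρ ^ (K * L) := by
          gcongr
          have := hx i j
          have : (0 : ℝ) ≤ L * S * |Λ| / Y := by positivity
          linarith
      _ ≤ 1 := hΛ
  · intro σ
    have hca := abs_sum_centred_le hf hg hinj σ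
    have hcb := abs_sum_centred_le hg hf (fun i j h h' => hinj i j h' h) σ
    rw [mul_comm (S : ℝ) (R : ℝ)] at hcb
    have e : ∑ j, (((σ j).2 : ℝ) - l0) * (A / Y * v j)
        = A * ∑ j, (((σ j).2 : ℝ) - l0) * ((f j : ℝ) - r0)
          + A * X / Y * ∑ j, (((σ j).2 : ℝ) - l0) * ((g j : ℝ) - s0) := by
      rw [Finset.mul_sum, Finset.mul_sum, ← Finset.sum_add_distrib]
      refine Finset.sum_congr rfl fun j _ => ?_
      simp only [v]
      field_simp
    rw [e]
    refine (abs_add_le _ _).trans ?_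
    have hAX : 0 ≤ A * X / Y := by positivity
    rw [abs_mul, abs_mul, abs_of_pos hA, abs_of_nonneg hAX]
    gcongr

theorem mul_log_succ_le (n : ℕ) : (n : ℝ) * Real.log (n + 1) ≤ n * Real.log n + 1 := by
  rcases n.eq_zero_or_pos with rfl | hn
  · simp
  have hn' : (0 : ℝ) < n := by exact_mod_cast hn
  have h := Real.log_le_sub_one_of_pos (x := ((n : ℝ) + 1) / n) (by positivity)
  rw [Real.log_div (by positivity) hn'.ne'] at h
  have h2 := mul_le_mul_of_nonneg_left h hn'.le
  have h3 : (n : ℝ) * (((n : ℝ) + 1) / n - 1) = 1 := by field_simp; ring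
  linarith

theorem mul_log_sub_add_one_le_log_factorial {n : ℕ} (hn : 1 ≤ n) :
    (n : ℝ) * Real.log n - n + 1 ≤ Real.log n.factorial := by
  induction n, hn using Nat.le_induction with
  | base => simp
  | succ n hn ih =>
    rw [Nat.factorial_succ, Nat.cast_mul, Real.log_mul (by positivity) (by positivity)]
    have := mul_log_succ_le n
    push_cast
    linarith

theorem le_sum_log_factorial (K : ℕ) :
    (K : ℝ) * (K - 1) / 2 * (Real.log K - 3 / 2) ≤
      ∑ k ∈ Finset.range K, Real.log k.factorial := by
  induction K with
  | zero => simp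
  | succ n ih =>
    rcases n.eq_zero_or_pos with rfl | hn
    · simp
    rw [Finset.sum_range_succ]
    have h1 := mul_log_sub_add_one_le_log_factorial hn
    have h2 := mul_log_succ_le n
    have hn' : (1 : ℝ) ≤ n := by exact_mod_cast hn
    have h3 := mul_le_mul_of_nonneg_left h2 (show (0 : ℝ) ≤ (n + 1) / 2 by positivity)
    push_cast
    nlinarith

theorem log_factorial_le (n : ℕ) : Real.log n.factorial ≤ n * Real.log n := by
  rw [← Real.log_pow]
  exact Real.log_le_log (by positivity) (by exact_mod_cast Nat.factorial_le_pow n)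

theorem cast_sum_range_id (n : ℕ) :
    ((∑ i ∈ Finset.range n, i : ℕ) : ℝ) = (n : ℝ) * (n - 1) / 2 := by
  induction n with
  | zero => simp
  | succ n ih => rw [Finset.sum_range_succ, Nat.cast_add, ih]; push_cast; ring

theorem interpolation_log_inequality {a b X Y K L R₁ S₁ R₂ S₂ R S : ℕ} (ha : 1 < a) (hb : 1 < b)
    (hY : 0 < Y) (hR₀ : 0 < R)
    (hL : L ≤ R₁ * S₁) (hKL : (K - 1) * L < R₂ * S₂)
    (hR : R₁ + R₂ ≤ R + 1) (hS : S₁ + S₂ ≤ S + 1)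
    (hab : ∀ r s r' s' : ℕ, a ^ r * b ^ s = a ^ r' * b ^ s' → r = r' ∧ s = s')
    (hXY : ∀ r s r' s' : ℕ, r < R₂ → s < S₂ → r' < R₂ → s' < S₂ →
      r * Y + s * X = r' * Y + s' * X → r = r' ∧ s = s')
    {ρ : ℝ} (hρ : 1 ≤ ρ)
    (hΛ : (L : ℝ) * S * |X * Real.log a - Y * Real.log b| / Y * ρ ^ (K * L) ≤ 1) :
    (K : ℝ) ^ 2 * L * (L - 1) / 2 * Real.log ρ ≤
      K * L * (Real.log (K * L) + Real.log 2)
        + L * (K * (K - 1) / 2) * (Real.log (((Y : ℝ) * R + X * S) / 2) - Real.log K + 3 / 2)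
        + L / 12 * √(K * L * (R * S)) * ((Real.log a * R + Real.log b * S)
          + ρ * (Real.log a * R + Real.log a * X / Y * S)) := by
  have h := interpolation_inequality ha hb hY hL hKL hR hS hab hXY hρ hΛ
  have hρ0 : 0 < ρ := by linarith
  have hV : 0 < ((Y : ℝ) * R + X * S) / 2 := by positivity
  set V := ((Y : ℝ) * R + X * S) / 2
  set Q := √((K : ℝ) * L * (R * S))
  have hprod : 0 < ∏ i : Fin K × Fin L, (ρ * V) ^ (i.1 : ℕ) / ((i.1 : ℕ).factorial : ℝ) :=
    Finset.prod_pos fun i _ => by positivity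
  have h1 := Real.log_le_log (Real.exp_pos _) h
  rw [Real.log_exp, Real.log_div (by positivity) (by positivity),
    Real.log_mul (by positivity) (by positivity), Real.log_mul (by positivity) (by positivity),
    Real.log_mul (by positivity) (by positivity), Real.log_exp, Real.log_pow, Real.log_pow,
    Real.log_prod (fun i _ => by positivity), Fintype.sum_prod_type] at h1
  simp only [Finset.sum_const, Finset.card_univ, Fintype.card_fin, nsmul_eq_mul] at h1
  rw [← Finset.mul_sum, ← Finset.sum_range
    (fun k : ℕ => Real.log ((ρ * V) ^ k / (k.factorial : ℝ)))] at h1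
  have h2 : ∑ k ∈ Finset.range K, Real.log ((ρ * V) ^ k / (k.factorial : ℝ))
      = (K : ℝ) * (K - 1) / 2 * (Real.log ρ + Real.log V)
        - ∑ k ∈ Finset.range K, Real.log k.factorial := by
    have h3 : ∀ k : ℕ, Real.log ((ρ * V) ^ k / (k.factorial : ℝ))
        = k * (Real.log ρ + Real.log V) - Real.log k.factorial := by
      intro k
      rw [Real.log_div (by positivity) (by positivity), Real.log_pow,
        Real.log_mul hρ0.ne' hV.ne']
    simp only [h3]
    rw [Finset.sum_sub_distrib, ← Finset.sum_mul]
    congr 2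
    have := cast_sum_range_id K
    push_cast at this
    exact this
  have h5 : ((∑ m ∈ Finset.range (K * L), m : ℕ) : ℝ) = (K * L : ℝ) * (K * L - 1) / 2 := by
    rw [cast_sum_range_id, Nat.cast_mul]
  rw [h2, h5] at h1
  have h6 := log_factorial_le (K * L)
  have h7 := mul_le_mul_of_nonneg_left (le_sum_log_factorial K) (Nat.cast_nonneg (α := ℝ) L)
  push_cast at h6 h1
  linarith

theorem log_five_gt : (1.609 : ℝ) < Real.log 5 := by
  have h : Real.log ((2 : ℝ) ^ 65) ≤ Real.log ((5 : ℝ) ^ 28) :=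
    Real.log_le_log (by norm_num) (by norm_num)
  rw [Real.log_pow, Real.log_pow] at h
  have := Real.log_two_gt_d9
  push_cast at h
  linarith

theorem log_five_lt : Real.log 5 < (1.6099 : ℝ) := by
  have h : Real.log ((5 : ℝ) ^ 31) ≤ Real.log ((2 : ℝ) ^ 72) :=
    Real.log_le_log (by norm_num) (by norm_num)
  rw [Real.log_pow, Real.log_pow] at h
  have := Real.log_two_lt_d9
  push_cast at h
  linarith

theorem log_three_gt : (1.0985 : ℝ) < Real.log 3 := by
  have h : Real.log ((2 : ℝ) ^ 84) ≤ Real.log ((3 : ℝ) ^ 53) :=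
    Real.log_le_log (by norm_num) (by norm_num)
  rw [Real.log_pow, Real.log_pow] at h
  have := Real.log_two_gt_d9
  push_cast at h
  linarith

theorem log_thirteen_lt : Real.log 13 < (2.575 : ℝ) := by
  have h : Real.log ((13 : ℝ) ^ 7) ≤ Real.log ((2 : ℝ) ^ 26) :=
    Real.log_le_log (by norm_num) (by norm_num)
  rw [Real.log_pow, Real.log_pow] at h
  have := Real.log_two_lt_d9
  push_cast at h
  linarith

theorem log_le_log_add_div {x c : ℝ} (hx : 0 < x) (hc : 0 < c) :
    Real.log x ≤ Real.log c - 1 + x / c := by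
  have := Real.log_le_sub_one_of_pos (x := x / c) (by positivity)
  rw [Real.log_div hx.ne' hc.ne'] at this
  linarith

set_option maxHeartbeats 1000000 in
theorem interpolation_parameters_contradiction {A B C t L K R S V : ℝ}
    (hA : 1.098 ≤ A) (hB : 0.693 ≤ B) (hL : 12 ≤ L) (ht : t < 22.87 * (L + 1) ^ 2)
    (hK₁ : 12.25 * L * (A * B) ≤ K) (hK₂ : K ≤ 12.25 * L * (A * B) + 1)
    (hR0 : 0 ≤ R) (hS0 : 0 ≤ S)
    (hR : A * R ≤ √(L * (A * B)) + √(K * (L * (A * B))) + A)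
    (hS : B * S ≤ √(L * (A * B)) + √(K * (L * (A * B))) + B)
    (hV0 : 0 < V) (hV : V ≤ t / 2 * (1.001 * (A * R + B * S))) (hC₀ : 0 ≤ C) (hC : C ≤ 1.001 * B)
    (h : K ^ 2 * L * (L - 1) / 2 * Real.log 5 ≤
      K * L * (Real.log (K * L) + Real.log 2)
        + L * (K * (K - 1) / 2) * (Real.log V - Real.log K + 3 / 2)
        + L / 12 * √(K * L * (R * S)) * ((A * R + B * S) + 5 * (A * R + C * S))) : False := by
  have hP : 0.7609 ≤ A * B := by
    calc (0.7609 : ℝ) ≤ 1.098 * 0.693 := by norm_num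
      _ ≤ A * B := by gcongr
  set P := A * B with hPdef
  have hKL : 9.32 * L ≤ K := by
    have := mul_le_mul_of_nonneg_left hP (show 0 ≤ L by linarith only [hL])
    linarith only [this, hK₁, hL]
  have hK : 111.84 ≤ K := by linarith only [hKL, hL]
  have hsq : √K ≤ 0.0947 * K := by
    apply Real.sqrt_le_iff.2 ⟨by positivity, ?_⟩
    have := mul_le_mul_of_nonneg_right hK (show 0 ≤ K by linarith)
    linarith
  have hLPK : L * P ≤ (2 / 7) ^ 2 * K := by linarith
  have hw1 : √(L * P) ≤ 2 / 7 * √K := by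
    rw [show 2 / 7 * √K = √((2 / 7) ^ 2 * K) by
      rw [Real.sqrt_mul (by positivity), Real.sqrt_sq (by norm_num)]]
    exact Real.sqrt_le_sqrt hLPK
  have hw2 : √(K * (L * P)) ≤ 2 / 7 * K := by
    apply Real.sqrt_le_iff.2 ⟨by positivity, ?_⟩
    calc K * (L * P) ≤ K * ((2 / 7) ^ 2 * K) := by gcongr
      _ = _ := by ring
  have hPK : P ≤ K / 147 := by
    have := mul_le_mul_of_nonneg_right hL (show 0 ≤ P by linarith only [hP])
    linarith only [this, hK₁]
  have hAK : 0.693 * A ≤ P := by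
    rw [mul_comm]
    exact mul_le_mul_of_nonneg_left hB (by linarith only [hA])
  have hBK : 1.098 * B ≤ P :=
    mul_le_mul_of_nonneg_right hA (by linarith only [hB])
  have hH : A * R + B * S ≤ 0.6416 * K := by
    linarith only [hR, hS, hw1, hw2, hsq, hPK, hAK, hBK, hK]
  have hRS : P * (R * S) ≤ (0.3208 * K) ^ 2 := by
    have h1 : 0 ≤ A * R := by positivity
    have h2 : 0 ≤ B * S := by positivity
    calc P * (R * S) = (A * R) * (B * S) := by rw [hPdef]; ring
      _ ≤ ((A * R + B * S) / 2) ^ 2 := by linarith only [sq_nonneg (A * R - B * S)]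
      _ ≤ _ := by gcongr; linarith
  have hroot : √(K * L * (R * S)) ≤ 1.128 * (L * K) := by
    apply Real.sqrt_le_iff.2 ⟨by positivity, ?_⟩
    have h1 : K ≤ 12.361 * L * P := by linarith only [hK₂, hK]
    calc K * L * (R * S) ≤ (12.361 * L * P) * L * (R * S) := by gcongr
      _ = 12.361 * L ^ 2 * (P * (R * S)) := by ring
      _ ≤ 12.361 * L ^ 2 * (0.3208 * K) ^ 2 := by gcongr
      _ = (12.361 * 0.3208 ^ 2) * (L * K) ^ 2 := by ring
      _ ≤ 1.128 ^ 2 * (L * K) ^ 2 := by gcongr; norm_num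
      _ = _ := by ring
  have hlast : L / 12 * √(K * L * (R * S)) * ((A * R + B * S) + 5 * (A * R + C * S))
      ≤ K ^ 2 * L * (0.36225 * L) := by
    have h1 : (A * R + B * S) + 5 * (A * R + C * S) ≤ 3.853 * K := by
      have : C * S ≤ 1.001 * (B * S) := by
        rw [← mul_assoc]
        exact mul_le_mul_of_nonneg_right hC hS0
      have : 0 ≤ A * R := by positivity
      have : 0 ≤ B * S := by positivity
      linarith only [this, ‹C * S ≤ _›, ‹0 ≤ A * R›, hH]
    calc _ ≤ L / 12 * (1.128 * (L * K)) * (3.853 * K) := by gcongr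
      _ = (1.128 * 3.853 / 12) * (K ^ 2 * L * L) := by ring
      _ ≤ 0.36225 * (K ^ 2 * L * L) := by gcongr; norm_num
      _ = _ := by ring
  have hlog2 := Real.log_two_lt_d9
  have hlogK : Real.log K ≤ 7 * Real.log 2 - 1 + K / 128 := by
    have := log_le_log_add_div (x := K) (c := 128) (by linarith) (by norm_num)
    rwa [show (128 : ℝ) = 2 ^ 7 by norm_num, Real.log_pow, ← show (128 : ℝ) = 2 ^ 7 by norm_num]
      at this
  have hfirst : Real.log (K * L) + Real.log 2 ≤ 0.0723 * K := by
    have h1 : Real.log (K * L) + Real.log 2 ≤ 2 * Real.log K - 2 * Real.log 2 := by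
      rw [← Real.log_mul (by positivity) (by norm_num)]
      have : Real.log (K * L * 2) ≤ Real.log (K ^ 2 / 2 ^ 2) := by
        apply Real.log_le_log (by positivity)
        have := mul_le_mul_of_nonneg_left hKL (show 0 ≤ K by linarith only [hK])
        have : 0 ≤ K * L := by positivity
        linarith
      rw [Real.log_div (by positivity) (by norm_num), Real.log_pow, Real.log_pow] at this
      push_cast at this
      exact this
    linarith
  have hmid : Real.log V - Real.log K + 3 / 2 ≤ 3.5 + 2 * Real.log (L + 1) := by
    have h1 : V ≤ Real.exp 1 ^ 2 * (L + 1) ^ 2 * K := by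
      have he := Real.exp_one_gt_d9
      have he2 : (7.38 : ℝ) ≤ Real.exp 1 ^ 2 := by nlinarith only [he]
      calc V ≤ t / 2 * (1.001 * (A * R + B * S)) := hV
        _ ≤ (22.87 * (L + 1) ^ 2) / 2 * (1.001 * (0.6416 * K)) := by gcongr
        _ = 22.87 / 2 * 1.001 * 0.6416 * (L + 1) ^ 2 * K := by ring
        _ ≤ _ := by gcongr; norm_num at he2 ⊢; linarith
    have h2 := Real.log_le_log hV0 h1
    rw [Real.log_mul (by positivity) (by positivity), Real.log_mul (by positivity) (by positivity),
      Real.log_pow, Real.log_pow, Real.log_exp] at h2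
    push_cast at h2
    linarith
  have hlogL := log_le_log_add_div (x := L + 1) (c := 13) (by linarith) (by norm_num)
  have hlogL0 : 0 ≤ Real.log (L + 1) := Real.log_nonneg (by linarith)
  have h13 := log_thirteen_lt
  have h5 := log_five_gt
  have e1 : K * L * (Real.log (K * L) + Real.log 2) ≤ K ^ 2 * L * 0.0723 := by
    calc _ ≤ K * L * (0.0723 * K) := by gcongr
      _ = _ := by ring
  have e2 : L * (K * (K - 1) / 2) * (Real.log V - Real.log K + 3 / 2)
      ≤ K ^ 2 * L * ((3.5 + 2 * Real.log (L + 1)) / 2) := by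
    have hK1 : 0 ≤ K - 1 := by linarith
    calc _ ≤ L * (K * (K - 1) / 2) * (3.5 + 2 * Real.log (L + 1)) := by gcongr
      _ ≤ L * (K * K / 2) * (3.5 + 2 * Real.log (L + 1)) := by gcongr; linarith
      _ = _ := by ring
  have e3 : K ^ 2 * L * ((L - 1) / 2 * Real.log 5) ≤
      K ^ 2 * L * (0.0723 + (3.5 + 2 * Real.log (L + 1)) / 2 + 0.36225 * L) := by
    linarith
  have e4 := le_of_mul_le_mul_left e3 (by positivity)
  have e5 : (L - 1) / 2 * 1.609 ≤ (L - 1) / 2 * Real.log 5 := by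
    gcongr
    linarith
  linarith

theorem Nat.Coprime.pow_mul_pow_inj {a b : ℕ} (hab : a.Coprime b) (ha : 1 < a) (hb : 1 < b)
    {r s r' s' : ℕ} (h : a ^ r * b ^ s = a ^ r' * b ^ s') : r = r' ∧ s = s' := by
  have key : ∀ r s r' s' : ℕ, a ^ r * b ^ s = a ^ r' * b ^ s' → ¬ r < r' := by
    intro r s r' s' h hlt
    obtain ⟨k, rfl⟩ := Nat.exists_eq_add_of_lt hlt
    have h1 : b ^ s = a ^ (k + 1) * b ^ s' := by
      apply Nat.eq_of_mul_eq_mul_left (show 0 < a ^ r by positivity)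
      rw [h]; ring
    have h2 : a ∣ b ^ s := h1 ▸ Dvd.dvd.mul_right (dvd_pow_self a (Nat.succ_ne_zero k)) _
    have := (hab.pow_right s).eq_one_of_dvd h2
    omega
  obtain rfl : r = r' := le_antisymm (not_lt.1 (key _ _ _ _ h.symm)) (not_lt.1 (key _ _ _ _ h))
  exact ⟨rfl, Nat.pow_right_injective hb (Nat.eq_of_mul_eq_mul_left (by positivity) h)⟩

theorem le_ceil_sqrt_mul_ceil_sqrt {A B : ℝ} (hA : 0 < A) (hB : 0 < B) (m : ℕ) :
    m ≤ ⌈√(m * (B / A))⌉₊ * ⌈√(m * (A / B))⌉₊ := by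
  have h : (m : ℝ) = √(m * (B / A)) * √(m * (A / B)) := by
    rw [← Real.sqrt_mul (by positivity), show (m : ℝ) * (B / A) * (m * (A / B)) = m ^ 2 by
      field_simp, Real.sqrt_sq (by positivity)]
  have h2 : (m : ℝ) ≤ (⌈√(m * (B / A))⌉₊ : ℝ) * ⌈√(m * (A / B))⌉₊ := by
    calc (m : ℝ) = √(m * (B / A)) * √(m * (A / B)) := h
      _ ≤ _ := by gcongr <;> exact Nat.le_ceil _
  exact_mod_cast h2

theorem mul_ceil_sqrt_lt {A B : ℝ} (hA : 0 < A) (hB : 0 < B) (m : ℕ) :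
    A * ⌈√(m * (B / A))⌉₊ < √(m * (A * B)) + A := by
  have h : A * √(m * (B / A)) = √(m * (A * B)) := by
    rw [show A * √(m * (B / A)) = √(A ^ 2) * √(m * (B / A)) by rw [Real.sqrt_sq hA.le],
      ← Real.sqrt_mul (by positivity)]
    congr 1
    field_simp
  rw [← h]
  have := mul_lt_mul_of_pos_left (Nat.ceil_lt_add_one (Real.sqrt_nonneg (m * (B / A)))) hA
  linarith

theorem exp_neg_div_two_le_abs_sub {a b p q : ℕ} (ha : 1 < a) (hb : 1 < b) (h : a ^ p ≠ b ^ q) :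
    Real.exp (-(q * Real.log b)) / 2 ≤ |p * Real.log a - q * Real.log b| := by
  have hx : (0 : ℝ) < (a : ℝ) ^ p := by positivity
  have hy : (0 : ℝ) < (b : ℝ) ^ q := by positivity
  have hy1 : (1 : ℝ) ≤ (b : ℝ) ^ q := one_le_pow₀ (by exact_mod_cast hb.le)
  rw [← Real.log_pow, ← Real.log_pow, Real.exp_neg, Real.exp_log hy, ← Real.log_div hx.ne' hy.ne']
  rcases lt_or_gt_of_ne h with h | h
  · have h1 : (a : ℝ) ^ p + 1 ≤ (b : ℝ) ^ q := by exact_mod_cast h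
    have h2 := Real.log_le_sub_one_of_pos (x := (a : ℝ) ^ p / (b : ℝ) ^ q) (by positivity)
    have h3 : (a : ℝ) ^ p / (b : ℝ) ^ q - 1 ≤ -((b : ℝ) ^ q)⁻¹ := by
      rw [div_sub_one hy.ne', inv_eq_one_div, ← neg_div]
      gcongr
      linarith
    have h4 : 0 < ((b : ℝ) ^ q)⁻¹ := by positivity
    rw [le_abs]
    right
    linarith
  · have h1 : (b : ℝ) ^ q + 1 ≤ (a : ℝ) ^ p := by exact_mod_cast h
    have h2 := Real.one_sub_inv_le_log_of_pos (x := (a : ℝ) ^ p / (b : ℝ) ^ q) (by positivity)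
    have h3 : ((b : ℝ) ^ q)⁻¹ / 2 ≤ 1 - ((a : ℝ) ^ p / (b : ℝ) ^ q)⁻¹ := by
      rw [inv_div]
      have : (b : ℝ) ^ q / (a : ℝ) ^ p ≤ (b : ℝ) ^ q / ((b : ℝ) ^ q + 1) := by gcongr
      have h5 : ((b : ℝ) ^ q)⁻¹ / 2 ≤ 1 - (b : ℝ) ^ q / ((b : ℝ) ^ q + 1) := by
        rw [one_sub_div (by positivity), add_sub_cancel_left, inv_eq_one_div, div_div]
        apply one_div_le_one_div_of_le (by positivity)
        linarith
      linarith
    exact (h3.trans h2).trans (le_abs_self _)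

theorem lattice_points_injective {a b X Y n : ℕ} (ha : 1 < a) (hb : 1 < b) (hab : a.Coprime b)
    (hY : 0 < Y) (hn : ∀ q < n, (q : ℝ) * Real.log b ≤ 0.1 * (Y * Real.log b))
    (hlog : 50 ≤ (Y : ℝ) * Real.log b)
    (hsmall : |X * Real.log a - Y * Real.log b| ≤ Real.exp (2 - 0.89 * (Y * Real.log b)))
    {r s r' s' : ℕ} (hs : s < n) (hs' : s' < n) (h : r * Y + s * X = r' * Y + s' * X) :
    r = r' ∧ s = s' := by
  have hY' : (0 : ℝ) < Y := by exact_mod_cast hY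
  have hB : 0 < Real.log b := Real.log_pos (by exact_mod_cast hb)
  have key : ∀ r s r' s' : ℕ, s' < n → r * Y + s * X = r' * Y + s' * X → ¬ s < s' := by
    intro r s r' s' hs' h hlt
    obtain ⟨q, rfl⟩ := Nat.exists_eq_add_of_lt hlt
    have hr : r' ≤ r := by
      apply Nat.le_of_mul_le_mul_right _ hY
      nlinarith
    obtain ⟨p, rfl⟩ := Nat.exists_eq_add_of_le hr
    have hpq : p * Y = (q + 1) * X := by nlinarith
    have hpq' : (p : ℝ) * Y = ((q + 1 : ℕ) : ℝ) * X := by exact_mod_cast hpq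
    have hne : a ^ p ≠ b ^ (q + 1) := by
      intro he
      have := (hab.pow_mul_pow_inj ha hb (r := p) (s := 0) (r' := 0) (s' := q + 1)
        (by simpa using he)).2
      omega
    have h1 := exp_neg_div_two_le_abs_sub ha hb hne
    have hq := hn (q + 1) (by omega)
    set Q := ((q + 1 : ℕ) : ℝ)
    have hQ : 0 < Q := by positivity
    have hQY : Q ≤ Y := by
      by_contra hc
      have := mul_lt_mul_of_pos_right (not_le.1 hc) hB
      have : 0 < (Y : ℝ) * Real.log b := by positivity
      linarith
    have h2 : Q * |X * Real.log a - Y * Real.log b| = Y * |p * Real.log a - Q * Real.log b| := by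
      rw [← abs_of_pos hQ, ← abs_mul, abs_of_pos hQ, ← abs_of_pos hY', ← abs_mul, abs_of_pos hY']
      congr 1
      linear_combination -Real.log a * hpq'
    have h3 : |p * Real.log a - Q * Real.log b| ≤ |X * Real.log a - Y * Real.log b| := by
      apply le_of_mul_le_mul_left _ hY'
      rw [← h2]
      gcongr
    have h4 : Real.exp (-(Q * Real.log b) - 1) ≤ Real.exp (-(Q * Real.log b)) / 2 := by
      rw [Real.exp_sub]
      have := Real.exp_one_gt_d9
      gcongr
      linarith
    have h5 := Real.exp_le_exp.1 (h4.trans (h1.trans (h3.trans hsmall)))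
    linarith
  obtain rfl : s = s' := le_antisymm (not_lt.1 (key _ _ _ _ hs h.symm)) (not_lt.1 (key _ _ _ _ hs' h))
  exact ⟨Nat.eq_of_mul_eq_mul_right hY (by omega), rfl⟩

set_option maxHeartbeats 1000000 in
/-- A lower bound for linear forms in two logarithms of coprime integers. -/
theorem four_mul_exp_lt_abs_linear_form {a b X Y : ℕ} (ha : 3 ≤ a) (hb : 2 ≤ b)
    (hab : a.Coprime b) (hY : 3294 * Real.log a ≤ Y) :
    4 * Real.exp (-0.89 * (Y * Real.log b)) < |X * Real.log a - Y * Real.log b| := by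
  by_contra! hsmall
  have hA : 1.098 ≤ Real.log a := by
    have := log_three_gt
    have : Real.log 3 ≤ Real.log a := Real.log_le_log (by norm_num) (by exact_mod_cast ha)
    linarith
  have hB : 0.693 ≤ Real.log b := by
    have := Real.log_two_gt_d9
    have : Real.log 2 ≤ Real.log b := Real.log_le_log (by norm_num) (by exact_mod_cast hb)
    linarith
  set A := Real.log a with hAdef
  set B := Real.log b with hBdef
  have hA0 : 0 < A := by linarith only [hA]
  have hB0 : 0 < B := by linarith only [hB]
  have hY0 : (0 : ℝ) < Y := by linarith only [hA, hY]
  set t := (Y : ℝ) / A with htdef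
  have hYt : (Y : ℝ) = t * A := by rw [htdef]; field_simp
  have ht : 3294 ≤ t := by rw [htdef, le_div_iff₀ hA0]; exact hY
  set P := A * B with hPdef
  have hP : 0.7609 ≤ P := by
    calc (0.7609 : ℝ) ≤ 1.098 * 0.693 := by norm_num
      _ ≤ A * B := by gcongr
  set T := (Y : ℝ) * B with hTdef
  have hT : T = t * P := by rw [hTdef, hPdef, hYt]; ring
  have htT : 0.7609 * t ≤ T := by
    rw [hT, mul_comm]; exact mul_le_mul_of_nonneg_left hP (by linarith only [ht])
  have hT0 : 2500 ≤ T := by linarith only [htT, ht]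
  have hsmall2 : |X * A - T| ≤ Real.exp (2 - 0.89 * T) := by
    refine hsmall.trans ?_
    rw [show 2 - 0.89 * T = 1 + 1 + -0.89 * T by ring, Real.exp_add, Real.exp_add]
    have := Real.exp_one_gt_d9
    gcongr
    nlinarith only [this]
  set L := ⌊√(t / 22.87)⌋₊ with hLdef
  have hL12 : 12 ≤ L := by
    rw [hLdef, Nat.le_floor_iff (Real.sqrt_nonneg _)]
    apply Real.le_sqrt_of_sq_le
    rw [le_div_iff₀ (by norm_num)]
    push_cast
    linarith only [ht]
  have hL12' : (12 : ℝ) ≤ L := by exact_mod_cast hL12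
  have hLt : 22.87 * (L : ℝ) ^ 2 ≤ t := by
    have h1 : (L : ℝ) ≤ √(t / 22.87) := Nat.floor_le (Real.sqrt_nonneg _)
    have h2 := (Real.le_sqrt (by positivity) (by positivity)).1 h1
    rw [le_div_iff₀ (by norm_num)] at h2
    linarith only [h2]
  have htL : t < 22.87 * ((L : ℝ) + 1) ^ 2 := by
    have h1 : √(t / 22.87) < (L : ℝ) + 1 := Nat.lt_floor_add_one _
    have h2 := (Real.sqrt_lt' (by positivity)).1 h1
    rw [div_lt_iff₀ (by norm_num)] at h2
    linarith only [h2]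
  set K := ⌈12.25 * (L : ℝ) * P⌉₊ with hKdef
  have hK₁ : 12.25 * (L : ℝ) * P ≤ K := Nat.le_ceil _
  have hK₂ : (K : ℝ) ≤ 12.25 * L * P + 1 :=
    (Nat.ceil_lt_add_one (by positivity)).le
  have hK0 : 0 < K := by
    have : (0 : ℝ) < K := lt_of_lt_of_le (by positivity) hK₁
    exact_mod_cast this
  have hK1' : (1 : ℝ) ≤ K := by exact_mod_cast hK0
  set M := (K - 1) * L + 1 with hMdef
  have hMK : (M : ℝ) ≤ K * L := by
    rw [hMdef]
    push_cast [Nat.cast_sub (show 1 ≤ K from hK0)]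
    linarith only [hL12']
  set R₁ := ⌈√(L * (B / A))⌉₊ with hR₁
  set S₁ := ⌈√(L * (A / B))⌉₊ with hS₁
  set R₂ := ⌈√(M * (B / A))⌉₊ with hR₂
  set S₂ := ⌈√(M * (A / B))⌉₊ with hS₂
  have hLRS : L ≤ R₁ * S₁ := le_ceil_sqrt_mul_ceil_sqrt hA0 hB0 L
  have hMRS : (K - 1) * L < R₂ * S₂ := le_ceil_sqrt_mul_ceil_sqrt hA0 hB0 M
  have hR₁pos : 0 < R₁ := Nat.ceil_pos.2 (by positivity)
  have hS₁pos : 0 < S₁ := Nat.ceil_pos.2 (by positivity)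
  have hR₂pos : 0 < R₂ := Nat.ceil_pos.2 (by positivity)
  have hMP : √(M * P) ≤ √(K * (L * P)) := by
    apply Real.sqrt_le_sqrt
    rw [← mul_assoc (K : ℝ)]
    gcongr
  have hAR₁ := mul_ceil_sqrt_lt hA0 hB0 L
  have hAR₂ := mul_ceil_sqrt_lt hA0 hB0 M
  have hBS₁ := mul_ceil_sqrt_lt hB0 hA0 L
  have hBS₂ := mul_ceil_sqrt_lt hB0 hA0 M
  rw [mul_comm B A, ← hPdef] at hBS₁ hBS₂
  rw [← hPdef] at hAR₁ hAR₂
  set R := R₁ + R₂ - 1 with hR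
  set S := S₁ + S₂ - 1 with hS
  have hRc : (R : ℝ) = R₁ + R₂ - 1 := by
    rw [hR, Nat.cast_sub (by omega)]; push_cast; rfl
  have hSc : (S : ℝ) = S₁ + S₂ - 1 := by
    rw [hS, Nat.cast_sub (by omega)]; push_cast; rfl
  have hAR : A * R ≤ √(L * P) + √(K * (L * P)) + A := by
    rw [hRc]; linarith only [hAR₁, hAR₂, hMP]
  have hBS : B * S ≤ √(L * P) + √(K * (L * P)) + B := by
    rw [hSc]; linarith only [hBS₁, hBS₂, hMP]
  have hLT : (L : ℝ) ≤ 0.0048 * T := by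
    have := mul_le_mul_of_nonneg_right hL12' (Nat.cast_nonneg (α := ℝ) L)
    linarith only [this, hLt, htT]
  have hNT : (K : ℝ) * L ≤ 0.5405 * T := by
    have h1 := mul_le_mul_of_nonneg_right hK₂ (Nat.cast_nonneg (α := ℝ) L)
    have h2 := mul_le_mul_of_nonneg_right hLt (show 0 ≤ P by linarith only [hP])
    rw [← hT] at h2
    linarith only [h1, h2, hLT]
  have hKT : (K : ℝ) ≤ 0.0451 * T := by
    have := mul_le_mul_of_nonneg_left hL12' (show (0 : ℝ) ≤ K by linarith only [hK1'])
    linarith only [this, hNT]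
  have hLPK : L * P ≤ (2 / 7) ^ 2 * K := by linarith only [hK₁]
  have hw2 : √(K * (L * P)) ≤ 2 / 7 * K := by
    apply Real.sqrt_le_iff.2 ⟨by positivity, ?_⟩
    calc K * (L * P) ≤ K * ((2 / 7) ^ 2 * K) := by gcongr
      _ = _ := by ring
  have hw1 : √(L * P) ≤ 2 / 7 * K := by
    refine (Real.sqrt_le_sqrt ?_).trans hw2
    exact le_mul_of_one_le_left (by positivity) hK1'
  have hLS : (L : ℝ) * S ≤ Y := by
    apply le_of_mul_le_mul_right _ hB0
    rw [← hTdef]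
    have h1 := mul_le_mul_of_nonneg_left hBS (Nat.cast_nonneg (α := ℝ) L)
    have h2 := mul_le_mul_of_nonneg_left hw1 (Nat.cast_nonneg (α := ℝ) L)
    have h3 := mul_le_mul_of_nonneg_left hw2 (Nat.cast_nonneg (α := ℝ) L)
    have h4 : (L : ℝ) * B ≤ 0.1 * T := by
      have h5 := mul_le_mul_of_nonneg_right hL12' (Nat.cast_nonneg (α := ℝ) L)
      have h6 := mul_le_mul_of_nonneg_left hA (show 0 ≤ t by linarith only [ht])
      rw [← hYt] at h6
      rw [hTdef, ← mul_assoc]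
      gcongr
      linarith only [h5, h6, hLt, hY0]
    linarith only [h1, h2, h3, h4, hNT, hT0]
  have hΛ1 : |X * A - T| ≤ 1 := by
    refine hsmall2.trans ?_
    rw [Real.exp_le_one_iff]
    linarith only [hT0]
  have hΛ : (L : ℝ) * S * |X * A - T| / Y * 5 ^ (K * L) ≤ 1 := by
    have h5 : (5 : ℝ) ^ (K * L) ≤ Real.exp (0.8702 * T) := by
      rw [← Real.exp_log (show (0 : ℝ) < 5 by norm_num), ← Real.exp_nat_mul, Real.exp_le_exp]
      have h6 := log_five_lt
      push_cast
      calc (K : ℝ) * L * Real.log 5 ≤ (0.5405 * T) * 1.6099 := by gcongr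
        _ ≤ _ := by linarith only [hT0]
    calc (L : ℝ) * S * |X * A - T| / Y * 5 ^ (K * L)
        ≤ Y * Real.exp (2 - 0.89 * T) / Y * Real.exp (0.8702 * T) := by gcongr
      _ = Real.exp (2 - 0.89 * T + 0.8702 * T) := by
          rw [mul_div_cancel_left₀ _ hY0.ne', Real.exp_add]
      _ ≤ 1 := by rw [Real.exp_le_one_iff]; linarith only [hT0]
  have hn : ∀ q < S₂, (q : ℝ) * B ≤ 0.1 * T := by
    intro q hq
    have h1 : (q : ℝ) + 1 ≤ S₂ := by exact_mod_cast hq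
    have h2 := mul_le_mul_of_nonneg_left h1 hB0.le
    linarith only [h2, hBS₂, hMP, hw2, hKT, hT0]
  have hlog := interpolation_log_inequality (a := a) (b := b) (X := X) (Y := Y) (K := K) (L := L)
    (R₁ := R₁) (S₁ := S₁) (R₂ := R₂) (S₂ := S₂) (R := R) (S := S) (by omega) (by omega)
    (by exact_mod_cast hY0) (by omega) hLRS hMRS (by omega) (by omega)
    (fun r s r' s' h => hab.pow_mul_pow_inj (by omega) (by omega) h)
    (fun r s r' s' _ hs _ hs' h => lattice_points_injective (by omega) (by omega) hab
      (by exact_mod_cast hY0) hn (by linarith only [hT0]) hsmall2 hs hs' h)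
    (show (1 : ℝ) ≤ 5 by norm_num) hΛ
  have hX : X * A ≤ 1.001 * T := by
    have := (abs_le.1 hΛ1).2
    linarith only [this, hT0]
  have hR0 : (0 : ℝ) < R := by
    have : 0 < R := by omega
    exact_mod_cast this
  refine interpolation_parameters_contradiction (C := A * X / Y) (V := ((Y : ℝ) * R + X * S) / 2)
    hA hB hL12' htL hK₁ hK₂ (Nat.cast_nonneg _) (Nat.cast_nonneg _) hAR hBS (by positivity) ?_
    (by positivity) ?_ hlog
  · have h1 : X * S ≤ t * (1.001 * (B * S)) := by
      have : (X : ℝ) ≤ t * (1.001 * B) := by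
        apply le_of_mul_le_mul_right _ hA0
        calc X * A ≤ 1.001 * T := hX
          _ = _ := by rw [hT, hPdef]; ring
      calc X * S ≤ t * (1.001 * B) * S := by gcongr
        _ = _ := by ring
    have h2 : (Y : ℝ) * R = t * (A * R) := by rw [hYt]; ring
    have h3 : 0 ≤ t * (A * R) := by positivity
    linarith only [h1, h2, h3]
  · rw [div_le_iff₀ hY0]
    linarith only [hX, hTdef]

theorem Nat.Prime.dvd_pow_sub_one_or_dvd_pow_add_one_iff {p b : ℕ} (hp : p.Prime) (hb : 0 < b)
    (m : ℕ) :
    (p ∣ b ^ m - 1 ∨ p ∣ b ^ m + 1) ↔ ((b : ZMod p) ^ 2) ^ m = 1 := by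
  have := Fact.mk hp
  have h1 : 1 ≤ b ^ m := Nat.one_le_pow _ _ hb
  rw [← pow_mul, mul_comm, pow_mul, ← one_pow (M := ZMod p) 2, sq_eq_sq_iff_eq_or_eq_neg,
    ← ZMod.natCast_eq_zero_iff, ← ZMod.natCast_eq_zero_iff, Nat.cast_sub h1]
  push_cast
  rw [sub_eq_zero, add_eq_zero_iff_eq_neg]

theorem orderOf_sq_eq_of_minimal {p b n : ℕ} (hp : p.Prime) (hb : 0 < b) (hn : 0 < n)
    (hpn : p ∣ b ^ n - 1 ∨ p ∣ b ^ n + 1)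
    (hmin : ∀ m, 0 < m → (p ∣ b ^ m - 1 ∨ p ∣ b ^ m + 1) → n ≤ m) :
    orderOf ((b : ZMod p) ^ 2) = n := by
  have key := hp.dvd_pow_sub_one_or_dvd_pow_add_one_iff hb
  rw [key] at hpn
  refine le_antisymm (orderOf_le_of_pow_eq_one hn hpn) (hmin _ ?_ ?_)
  · exact orderOf_pos_iff.2 (isOfFinOrder_iff_pow_eq_one.2 ⟨n, hn, hpn⟩)
  · rw [key]
    exact pow_orderOf_eq_one _

theorem padicValNat_sq_sub_one_of_ne_two {p c : ℕ} (hp : p.Prime) (hp2 : p ≠ 2) (hc : 1 < c) :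
    padicValNat p (c ^ 2 - 1) = max (padicValNat p (c - 1)) (padicValNat p (c + 1)) := by
  have := Fact.mk hp
  have h : c ^ 2 - 1 = (c + 1) * (c - 1) := by
    simpa using Nat.sq_sub_sq c 1
  rw [h, padicValNat.mul (by omega) (by omega)]
  have h3 : ¬ p ∣ c - 1 ∨ ¬ p ∣ c + 1 := by
    by_contra! h4
    have h5 : p ∣ 2 := by
      have := (Nat.dvd_sub h4.2 h4.1)
      rwa [show c + 1 - (c - 1) = 2 by omega] at this
    exact hp2 ((Nat.prime_dvd_prime_iff_eq hp Nat.prime_two).1 h5)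
  rcases h3 with h3 | h3
  · rw [padicValNat.eq_zero_of_not_dvd h3]; simp
  · rw [padicValNat.eq_zero_of_not_dvd h3]; simp

theorem padicValNat_two_sub_one_add_add_one_le {b : ℕ} (hb : 1 < b) :
    padicValNat 2 (b - 1) + padicValNat 2 (b + 1)
      ≤ max (padicValNat 2 (b - 1)) (padicValNat 2 (b + 1)) + 1 := by
  have h4 : ¬ 2 ^ 2 ∣ b - 1 ∨ ¬ 2 ^ 2 ∣ b + 1 := by omega
  rcases h4 with h4 | h4
  · rw [padicValNat_dvd_iff_le (by omega)] at h4
    have := le_max_right (padicValNat 2 (b - 1)) (padicValNat 2 (b + 1))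
    omega
  · rw [padicValNat_dvd_iff_le (by omega)] at h4
    have := le_max_left (padicValNat 2 (b - 1)) (padicValNat 2 (b + 1))
    omega

theorem minimal_exponent_two_eq_one {b n : ℕ} (hb : Odd b) (hn : 0 < n)
    (hmin : ∀ m, 0 < m → (2 ∣ b ^ m - 1 ∨ 2 ∣ b ^ m + 1) → n ≤ m) : n = 1 := by
  have := hmin 1 one_pos (Or.inr (by simpa using hb.add_one.two_dvd))
  omega

theorem padicValNat_pow_sub_one_le {p b n d : ℕ} (hp : p.Prime) (hb : 1 < b) (hpb : ¬ p ∣ b)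
    (hn : 0 < n) (hpn : p ∣ b ^ n - 1 ∨ p ∣ b ^ n + 1)
    (hmin : ∀ m, 0 < m → (p ∣ b ^ m - 1 ∨ p ∣ b ^ m + 1) → n ≤ m)
    (hd : 0 < d) (hpd : p ∣ b ^ d - 1) :
    padicValNat p (b ^ d - 1)
      ≤ max (padicValNat p (b ^ n - 1)) (padicValNat p (b ^ n + 1)) + padicValNat p d := by
  have := Fact.mk hp
  have hbd : 1 < b ^ d := Nat.one_lt_pow hd.ne' hb
  have hsq : (b ^ d) ^ 2 - 1 = (b ^ d + 1) * (b ^ d - 1) := by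
    simpa using Nat.sq_sub_sq (b ^ d) 1
  have hmul := padicValNat.mul (p := p) (a := b ^ d + 1) (b := b ^ d - 1) (by omega) (by omega)
  rw [← hsq] at hmul
  rcases eq_or_ne p 2 with rfl | hp2
  · have hodd : Odd b := by
      rw [← Nat.not_even_iff_odd, even_iff_two_dvd]; exact hpb
    obtain rfl := minimal_exponent_two_eq_one hodd hn hmin
    have h1 := padicValNat.pow_two_sub_pow (x := b) (y := 1) hb
      (by obtain ⟨k, rfl⟩ := hodd; simp) hpb (n := d * 2) (by omega) (by simp)
    rw [one_pow, pow_mul, hmul, padicValNat.mul hd.ne' two_ne_zero, padicValNat.self one_lt_two]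
      at h1
    have h2 := padicValNat_two_sub_one_add_add_one_le hb
    have h3 : 1 ≤ padicValNat 2 (b ^ d + 1) := by
      rw [← padicValNat_dvd_iff_le (by omega)]
      simpa using (hodd.pow (n := d)).add_one.two_dvd
    simp only [pow_one]
    omega
  · have hnd : n ∣ d := by
      rw [← orderOf_sq_eq_of_minimal hp (by omega) hn hpn hmin]
      exact orderOf_dvd_of_pow_eq_one
        ((hp.dvd_pow_sub_one_or_dvd_pow_add_one_iff (by omega) d).1 (Or.inl hpd))
    obtain ⟨q, rfl⟩ := hnd
    have hc : 1 < b ^ n := Nat.one_lt_pow hn.ne' hb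
    have hc2 : (b ^ n) ^ 2 - 1 = (b ^ n + 1) * (b ^ n - 1) := by
      simpa using Nat.sq_sub_sq (b ^ n) 1
    have hdiv : p ∣ (b ^ n) ^ 2 - 1 := by
      rw [hc2]
      rcases hpn with h | h
      · exact h.mul_left _
      · exact h.mul_right _
    have h1 := padicValNat.pow_sub_pow (x := (b ^ n) ^ 2) (y := 1) (hp.odd_of_ne_two hp2)
      (Nat.one_lt_pow two_ne_zero hc) hdiv
      (fun h => hpb (hp.dvd_of_dvd_pow (hp.dvd_of_dvd_pow h))) (n := q)
      (by rintro rfl; simp at hd)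
    rw [one_pow, padicValNat_sq_sub_one_of_ne_two hp hp2 hc,
      show ((b ^ n) ^ 2) ^ q = (b ^ (n * q)) ^ 2 by ring, hmul] at h1
    have h2 : padicValNat p q ≤ padicValNat p (n * q) := by
      rw [padicValNat.mul hn.ne' (by rintro rfl; simp at hd)]
      omega
    omega

theorem two_mul_minimal_exponent_add_one_le {p b n : ℕ} (hp : p.Prime) (hb : 0 < b)
    (hpb : ¬ p ∣ b) (hn : 0 < n)
    (hmin : ∀ m, 0 < m → (p ∣ b ^ m - 1 ∨ p ∣ b ^ m + 1) → n ≤ m) :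
    2 * (n + 1) ≤ p + 1 + if p = 2 then 1 else 0 := by
  have := Fact.mk hp
  rcases eq_or_ne p 2 with rfl | hp2
  · have hodd : Odd b := by
      rw [← Nat.not_even_iff_odd, even_iff_two_dvd]; exact hpb
    obtain rfl := minimal_exponent_two_eq_one hodd hn hmin
    simp
  · have hodd := hp.odd_of_ne_two hp2
    have h2 := hp.two_le
    have h0 : (b : ZMod p) ≠ 0 := by rwa [Ne, ZMod.natCast_eq_zero_iff]
    have h := hmin (p / 2) (by omega) <| by
      rw [hp.dvd_pow_sub_one_or_dvd_pow_add_one_iff hb, ← pow_mul, mul_comm, pow_mul,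
        ← one_pow 2, sq_eq_sq_iff_eq_or_eq_neg]
      exact ZMod.pow_div_two_eq_neg_one_or_one p h0
    rw [if_neg hp2]
    obtain ⟨k, rfl⟩ := hodd
    omega

theorem pow_max_padicValNat_le {p b n : ℕ} (hb : 1 < b) (hn : 0 < n) :
    p ^ max (padicValNat p (b ^ n - 1)) (padicValNat p (b ^ n + 1)) ≤ b ^ (n + 1) := by
  have h1 : 1 < b ^ n := Nat.one_lt_pow hn.ne' hb
  have h2 : b ^ n + 1 ≤ b ^ (n + 1) := by
    rw [pow_succ]; nlinarith
  rcases max_choice (padicValNat p (b ^ n - 1)) (padicValNat p (b ^ n + 1)) with h | h <;> rw [h]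
  · exact (Nat.le_of_dvd (by omega) pow_padicValNat_dvd).trans (by omega)
  · exact (Nat.le_of_dvd (by omega) pow_padicValNat_dvd).trans h2

theorem sum_add_one_le_prod_add_one (s : Finset ℕ) (hs : ∀ p ∈ s, 2 ≤ p)
    (hne : s.Nonempty) : ∑ p ∈ s, (p + 1) ≤ ∏ p ∈ s, p + 1 := by
  induction hne using Finset.Nonempty.cons_induction with
  | singleton a => simp
  | cons q s hq hne ih =>
    rw [Finset.sum_cons, Finset.prod_cons]
    have ih := ih fun p hp => hs p (Finset.mem_cons_of_mem hp)
    have hq2 := hs q (Finset.mem_cons_self q s)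
    have hp2 : ∀ p ∈ s, 2 ≤ p := fun p hp => hs p (Finset.mem_cons_of_mem hp)
    set Q := ∏ p ∈ s, p
    have : 2 ≤ Q := by
      obtain ⟨p, hp⟩ := hne
      refine (hp2 p hp).trans (Finset.single_le_prod' (f := id) (fun i hi => ?_) hp)
      exact one_le_two.trans (hp2 i hi)
    have h3 : 3 ≤ q ∨ 3 ≤ Q := by
      by_contra! h
      have hq' : q = 2 := by omega
      have hQ' : Q = 2 := by omega
      obtain ⟨p, hp⟩ := hne
      have h1 : p ≤ Q := Finset.single_le_prod' (f := id)
        (fun i hi => one_le_two.trans (hp2 i hi)) hp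
      have h2 := hp2 p hp
      have : p = q := by omega
      exact hq (this ▸ hp)
    rcases h3 with h3 | h3 <;> nlinarith

theorem Real.log_eq_sum_primeFactors (n : ℕ) :
    Real.log n = ∑ p ∈ n.primeFactors, (padicValNat p n : ℝ) * Real.log p := by
  rw [Real.log_nat_eq_sum_factorization, Finsupp.sum, Nat.support_factorization]
  refine Finset.sum_congr rfl fun p hp => ?_
  rw [Nat.factorization_def n (Nat.prime_of_mem_primeFactors hp)]

theorem sum_padicValNat_mul_log_le_log {s : Finset ℕ} (hs : ∀ p ∈ s, p.Prime) {d : ℕ}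
    (hd : 0 < d) :
    ∑ p ∈ s, (padicValNat p d : ℝ) * Real.log p ≤ Real.log d := by
  rw [Real.log_eq_sum_primeFactors d]
  calc ∑ p ∈ s, (padicValNat p d : ℝ) * Real.log p
      = ∑ p ∈ s ∩ d.primeFactors, (padicValNat p d : ℝ) * Real.log p := by
        refine (Finset.sum_subset Finset.inter_subset_left fun p hp hp' => ?_).symm
        rw [padicValNat.eq_zero_of_not_dvd, Nat.cast_zero, zero_mul]
        intro hpd
        exact hp' (Finset.mem_inter.2 ⟨hp, Nat.mem_primeFactors.2 ⟨hs p hp, hpd, hd.ne'⟩⟩)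
    _ ≤ _ := Finset.sum_le_sum_of_subset_of_nonneg Finset.inter_subset_right
        fun p _ _ => mul_nonneg (Nat.cast_nonneg _) (Real.log_natCast_nonneg p)

theorem not_dvd_of_mem_primeFactors_of_coprime {a b p : ℕ} (hab : a.Coprime b)
    (hp : p ∈ a.primeFactors) : ¬ p ∣ b :=
  fun h => (Nat.prime_of_mem_primeFactors hp).one_lt.ne'
    (Nat.eq_one_of_dvd_coprimes hab (Nat.dvd_of_mem_primeFactors hp) h)

section

variable {a b : ℕ} {n g : ℕ → ℕ}

theorem mul_log_le_sum_add_log_of_pow_dvd (hb : 1 < b) (hab : a.Coprime b)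
    (hn : ∀ p ∈ a.primeFactors, 0 < n p ∧ (p ∣ b ^ (n p) - 1 ∨ p ∣ b ^ (n p) + 1) ∧
      ∀ m : ℕ, 0 < m → (p ∣ b ^ m - 1 ∨ p ∣ b ^ m + 1) → n p ≤ m)
    (hg : ∀ p ∈ a.primeFactors,
      g p = max (padicValNat p (b ^ (n p) - 1)) (padicValNat p (b ^ (n p) + 1)))
    {x d : ℕ} (hx : 0 < x) (hd : 0 < d) (h : a ^ x ∣ b ^ d - 1) :
    x * Real.log a ≤ ∑ p ∈ a.primeFactors, (g p : ℝ) * Real.log p + Real.log d := by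
  have hbd : 1 < b ^ d := Nat.one_lt_pow hd.ne' hb
  have h1 := sum_padicValNat_mul_log_le_log (s := a.primeFactors)
    (fun p hp => Nat.prime_of_mem_primeFactors hp) hd
  suffices x * Real.log a ≤ ∑ p ∈ a.primeFactors, (g p : ℝ) * Real.log p
      + ∑ p ∈ a.primeFactors, (padicValNat p d : ℝ) * Real.log p by linarith
  rw [Real.log_eq_sum_primeFactors a, Finset.mul_sum, ← Finset.sum_add_distrib]
  refine Finset.sum_le_sum fun p hp => ?_
  have hpp := Nat.prime_of_mem_primeFactors hp
  have := Fact.mk hpp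
  obtain ⟨hn0, hn1, hn2⟩ := hn p hp
  have hpd : p ∣ b ^ d - 1 :=
    (Nat.dvd_of_mem_primeFactors hp).trans ((dvd_pow_self a hx.ne').trans h)
  have h2 := padicValNat_pow_sub_one_le hpp hb (not_dvd_of_mem_primeFactors_of_coprime hab hp)
    hn0 hn1 hn2 hd hpd
  rw [← hg p hp] at h2
  have h3 : x * padicValNat p a ≤ padicValNat p (b ^ d - 1) := by
    rw [← padicValNat.pow, ← padicValNat_dvd_iff_le (by omega)]
    exact pow_padicValNat_dvd.trans h
  have h4 : (x * padicValNat p a : ℝ) ≤ g p + padicValNat p d := by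
    exact_mod_cast h3.trans h2
  rw [← add_mul, ← mul_assoc]
  exact mul_le_mul_of_nonneg_right h4 (Real.log_natCast_nonneg p)

theorem two_mul_sum_mul_log_le (ha : 2 < a) (hb : 1 < b) (hab : a.Coprime b)
    (hn : ∀ p ∈ a.primeFactors, 0 < n p ∧ (p ∣ b ^ (n p) - 1 ∨ p ∣ b ^ (n p) + 1) ∧
      ∀ m : ℕ, 0 < m → (p ∣ b ^ m - 1 ∨ p ∣ b ^ m + 1) → n p ≤ m)
    (hg : ∀ p ∈ a.primeFactors,
      g p = max (padicValNat p (b ^ (n p) - 1)) (padicValNat p (b ^ (n p) + 1))) :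
    2 * ∑ p ∈ a.primeFactors, (g p : ℝ) * Real.log p ≤ (a + 2) * Real.log b := by
  have hB : 0 ≤ Real.log b := Real.log_natCast_nonneg b
  have h1 : ∑ p ∈ a.primeFactors, 2 * (n p + 1) ≤ a + 2 := by
    calc ∑ p ∈ a.primeFactors, 2 * (n p + 1)
        ≤ ∑ p ∈ a.primeFactors, (p + 1 + if p = 2 then 1 else 0) :=
          Finset.sum_le_sum fun p hp =>
            two_mul_minimal_exponent_add_one_le (Nat.prime_of_mem_primeFactors hp) (by omega)
              (not_dvd_of_mem_primeFactors_of_coprime hab hp) (hn p hp).1 (hn p hp).2.2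
      _ = ∑ p ∈ a.primeFactors, (p + 1) + if 2 ∈ a.primeFactors then 1 else 0 := by
          rw [Finset.sum_add_distrib, Finset.sum_ite_eq']
      _ ≤ (∏ p ∈ a.primeFactors, p + 1) + 1 := by
          refine add_le_add (sum_add_one_le_prod_add_one _
            (fun p hp => (Nat.prime_of_mem_primeFactors hp).two_le)
            (Nat.nonempty_primeFactors.2 (by omega))) ?_
          split_ifs <;> omega
      _ ≤ a + 2 := by
          have := Nat.le_of_dvd (by omega) (Nat.prod_primeFactors_dvd a)
          omega
  have h2 : ∀ p ∈ a.primeFactors, (g p : ℝ) * Real.log p ≤ (n p + 1) * Real.log b := by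
    intro p hp
    have h3 := pow_max_padicValNat_le (p := p) hb (hn p hp).1
    rw [← hg p hp] at h3
    have h4 : (p : ℝ) ^ g p ≤ (b : ℝ) ^ (n p + 1) := by exact_mod_cast h3
    have hp0 : (0 : ℝ) < p := by exact_mod_cast (Nat.prime_of_mem_primeFactors hp).pos
    have h5 := Real.log_le_log (by positivity) h4
    rw [Real.log_pow, Real.log_pow] at h5
    exact_mod_cast h5
  have h3 := Finset.sum_le_sum h2
  rw [← Finset.sum_mul] at h3
  have h4 : 2 * ∑ p ∈ a.primeFactors, ((n p : ℝ) + 1) ≤ a + 2 := by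
    rw [Finset.mul_sum]
    exact_mod_cast h1
  nlinarith only [mul_le_mul_of_nonneg_right h4 hB, h3]

end

theorem exp_eight_one_ge : 3294 ≤ Real.exp 8.1 := by
  refine le_of_pow_le_pow_left₀ (n := 10) (by norm_num) (Real.exp_pos _).le ?_
  rw [← Real.exp_nat_mul, show ((10 : ℕ) : ℝ) * 8.1 = (81 : ℕ) * 1 by norm_num,
    Real.exp_nat_mul]
  calc (3294 : ℝ) ^ 10 ≤ 2.7182818283 ^ 81 := by norm_num
    _ ≤ _ := pow_le_pow_left₀ (by norm_num) Real.exp_one_gt_d9.le _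

theorem exp_ten_quarter_ge : 28282 ≤ Real.exp 10.25 := by
  refine le_of_pow_le_pow_left₀ (n := 4) (by norm_num) (Real.exp_pos _).le ?_
  rw [← Real.exp_nat_mul, show ((4 : ℕ) : ℝ) * 10.25 = (41 : ℕ) * 1 by norm_num,
    Real.exp_nat_mul]
  calc (28282 : ℝ) ^ 4 ≤ 2.7182818283 ^ 41 := by norm_num
    _ ≤ _ := pow_le_pow_left₀ (by norm_num) Real.exp_one_gt_d9.le _

theorem add_two_le_mul_log_of_lt {a : ℕ} (ha : 2 < a) (ha' : a < 5346) :
    (a : ℝ) + 2 ≤ 691.7 * Real.log a := by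
  have key : ∀ k : ℕ, 2 ^ k ≤ a → k * Real.log 2 ≤ Real.log a := fun k hk => by
    rw [← Real.log_pow]
    exact Real.log_le_log (by positivity) (by exact_mod_cast hk)
  have l2 := Real.log_two_gt_d9
  rcases lt_or_ge a 512 with h | h
  · have h1 : Real.log 3 ≤ Real.log a := Real.log_le_log (by norm_num) (by exact_mod_cast ha)
    have h2 : (a : ℝ) < 512 := by exact_mod_cast h
    linarith [log_three_gt]
  rcases lt_or_ge a 4096 with h' | h'
  · have h1 := key 9 h
    have h2 : (a : ℝ) < 4096 := by exact_mod_cast h'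
    push_cast at h1
    linarith
  · have h1 := key 12 h'
    have h2 : (a : ℝ) < 5346 := by exact_mod_cast ha'
    push_cast at h1
    linarith

theorem log_ge_of_le {a : ℕ} (ha : 5346 ≤ a) : (8.58406 : ℝ) ≤ Real.log a := by
  have h1 : Real.log 5346 ≤ Real.log a := Real.log_le_log (by norm_num) (by exact_mod_cast ha)
  have h : Real.log (((2 : ℝ) ^ 181) ^ 13) ≤ Real.log ((5346 : ℝ) ^ 190) :=
    Real.log_le_log (by norm_num) (by norm_num)
  rw [Real.log_pow, Real.log_pow, Real.log_pow] at h
  push_cast at h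
  linarith [Real.log_two_gt_d9]

theorem le_of_mul_log_le_log {a d : ℕ} (ha : 2 < a) (hd : 0 < d)
    (h : (if a < 5346 then (8.1 + Real.log (Real.log a)) / Real.log a
      else 1.19408) * Real.log a ≤ Real.log d) :
    3294 * Real.log a ≤ d ∧ (a : ℝ) + 2 ≤ 0.21 * d := by
  have ha0 : (0 : ℝ) < a := by exact_mod_cast (by omega : 0 < a)
  have hA : 0 < Real.log a := Real.log_pos (by exact_mod_cast (by omega : 1 < a))
  have hd0 : (0 : ℝ) < d := by exact_mod_cast hd
  rw [Real.le_log_iff_exp_le hd0] at h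
  split_ifs at h with h'
  · rw [div_mul_cancel₀ _ hA.ne', Real.exp_add, Real.exp_log hA] at h
    have h1 : 3294 * Real.log a ≤ d :=
      (mul_le_mul_of_nonneg_right exp_eight_one_ge hA.le).trans h
    exact ⟨h1, by linarith [add_two_le_mul_log_of_lt ha h']⟩
  · have hz := log_ge_of_le (not_lt.1 h')
    constructor
    · refine le_trans ?_ h
      have h1 : Real.exp (1.19408 * Real.log a)
          = Real.exp 10.25 * Real.exp (1.19408 * Real.log a - 10.25) := by
        rw [← Real.exp_add]; congr 1; ring
      rw [h1]
      have h2 := Real.add_one_le_exp (1.19408 * Real.log a - 10.25)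
      have h3 := mul_le_mul exp_ten_quarter_ge h2 (by linarith) (Real.exp_pos _).le
      linarith
    · have h1 : Real.exp (1.19408 * Real.log a) = a * Real.exp (0.19408 * Real.log a) := by
        nth_rewrite 2 [← Real.exp_log ha0]
        rw [← Real.exp_add]; congr 1; ring
      have h2 : (5 : ℝ) ≤ Real.exp (0.19408 * Real.log a) := by
        rw [← Real.log_le_iff_le_exp (by norm_num)]
        linarith [log_five_lt]
      rw [h1] at h
      have h3 := mul_le_mul_of_nonneg_left h2 ha0.le
      have h4 : (5346 : ℝ) ≤ a := by exact_mod_cast not_lt.1 h'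
      linarith

theorem abs_log_le_two_mul_abs_sub_one {q : ℝ} (hq : 1 / 2 ≤ q) :
    |Real.log q| ≤ 2 * |q - 1| := by
  have hq0 : 0 < q := by linarith
  have h1 := Real.log_le_sub_one_of_pos hq0
  have h2 := Real.one_sub_inv_le_log_of_pos hq0
  rw [abs_le]
  constructor
  · have h3 : 1 - q⁻¹ = -((1 - q) * q⁻¹) := by field_simp; ring
    have h4 : q⁻¹ ≤ 2 := by
      rw [inv_le_comm₀ hq0 two_pos]; linarith
    have h5 : (1 - q) * q⁻¹ ≤ |q - 1| * 2 := by
      refine mul_le_mul ?_ h4 (by positivity) (abs_nonneg _)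
      rw [abs_sub_comm]; exact le_abs_self _
    linarith
  · linarith [le_abs_self (q - 1), abs_nonneg (q - 1)]

/-- Two solutions of `±a ^ x ± b ^ y = r` determine the same difference of powers. -/
theorem exists_pow_eq_of_two_solutions {a b r u v x₁ y₁ x₂ y₂ : ℕ} (ha : 2 < a) (hb : 1 < b)
    (hab : a.Coprime b) (hr : 0 < r) (hu : u ≤ 1) (hv : v ≤ 1)
    (hne : (x₁, y₁) ≠ (x₂, y₂)) (hxle : x₁ ≤ x₂) (hyle : y₁ ≤ y₂)
    (heq₁ : (-1 : ℤ) ^ u * (a : ℤ) ^ x₁ + (-1) ^ v * (b : ℤ) ^ y₁ = r)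
    (heq₂ : (-1 : ℤ) ^ u * (a : ℤ) ^ x₂ + (-1) ^ v * (b : ℤ) ^ y₂ = r) :
    ∃ d, 0 < d ∧ d ≤ y₂ ∧ a ^ x₁ ∣ b ^ d - 1 ∧ |(a : ℤ) ^ x₂ - (b : ℤ) ^ y₂| = r := by
  have ha1 : (1 : ℤ) < a := by exact_mod_cast (by omega : 1 < a)
  have hb1 : (1 : ℤ) < b := by exact_mod_cast hb
  have hA : (a : ℤ) ^ x₁ ≤ (a : ℤ) ^ x₂ := pow_le_pow_right₀ ha1.le hxle
  have hB : (b : ℤ) ^ y₁ ≤ (b : ℤ) ^ y₂ := pow_le_pow_right₀ hb1.le hyle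
  have hr' : (0 : ℤ) < r := by exact_mod_cast hr
  have hpa : (0 : ℤ) < (a : ℤ) ^ x₁ := by positivity
  have hpb : (0 : ℤ) < (b : ℤ) ^ y₁ := by positivity
  have main : (a : ℤ) ^ x₂ - (a : ℤ) ^ x₁ = (b : ℤ) ^ y₂ - (b : ℤ) ^ y₁ ∧
      |(a : ℤ) ^ x₂ - (b : ℤ) ^ y₂| = r := by
    interval_cases u <;> interval_cases v <;>
      simp only [pow_zero, pow_one, one_mul, neg_mul] at heq₁ heq₂
    · exfalso
      refine hne (Prod.ext ?_ ?_)
      · exact pow_right_injective₀ (by omega) (by omega) (by linarith : (a : ℤ) ^ x₁ = (a : ℤ) ^ x₂)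
      · exact pow_right_injective₀ (by omega) (by omega) (by linarith : (b : ℤ) ^ y₁ = (b : ℤ) ^ y₂)
    · exact ⟨by linarith, by rw [abs_of_pos] <;> linarith⟩
    · exact ⟨by linarith, by rw [abs_of_neg] <;> linarith⟩
    · linarith
  obtain ⟨hdiff, habs⟩ := main
  have hylt : y₁ < y₂ := by
    refine lt_of_le_of_ne hyle fun h => hne ?_
    subst h
    have : (a : ℤ) ^ x₁ = (a : ℤ) ^ x₂ := by linarith
    rw [pow_right_injective₀ (by omega) (by omega) this]
  refine ⟨y₂ - y₁, by omega, by omega, ?_, habs⟩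
  have h1 : (a : ℤ) ^ x₁ ∣ (b : ℤ) ^ y₁ * ((b : ℤ) ^ (y₂ - y₁) - 1) := by
    rw [mul_sub, ← pow_add, Nat.add_sub_cancel' hyle, mul_one, ← hdiff]
    exact dvd_sub (pow_dvd_pow _ hxle) dvd_rfl
  have h2 : IsCoprime ((a : ℤ) ^ x₁) ((b : ℤ) ^ y₁) :=
    (Nat.isCoprime_iff_coprime.2 hab).pow
  have h3 := h2.dvd_of_dvd_mul_left h1
  rw [← Int.natCast_dvd_natCast, Nat.cast_sub (Nat.one_le_pow _ _ (by omega))]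
  exact_mod_cast h3

theorem proposition3_bound
    (a b : ℕ) (ha : 2 < a) (hb : 1 < b) (hab : Nat.Coprime a b)
    (r : ℕ) (hr : 0 < r) (u v : ℕ) (hu : u ≤ 1) (hv : v ≤ 1)
    (n g : ℕ → ℕ)
    (hn : ∀ p ∈ a.primeFactors, 0 < n p ∧
      (p ∣ b ^ (n p) - 1 ∨ p ∣ b ^ (n p) + 1) ∧
      ∀ m : ℕ, 0 < m → (p ∣ b ^ m - 1 ∨ p ∣ b ^ m + 1) → n p ≤ m)
    (hg : ∀ p ∈ a.primeFactors,
      g p = max (padicValNat p (b ^ (n p) - 1)) (padicValNat p (b ^ (n p) + 1)))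
    (S : ℝ)
    (hS : S = (∑ p ∈ a.primeFactors, (g p : ℝ) * Real.log p) / Real.log a)
    (x₁ y₁ x₂ y₂ : ℕ) (hx₁ : 0 < x₁) (hy₁ : 0 < y₁) (hx₂ : 0 < x₂) (hy₂ : 0 < y₂)
    (hne : (x₁, y₁) ≠ (x₂, y₂)) (hxle : x₁ ≤ x₂) (hyle : y₁ ≤ y₂)
    (heq₁ : (-1 : ℤ) ^ u * (a : ℤ) ^ x₁ + (-1) ^ v * (b : ℤ) ^ y₁ = r)
    (heq₂ : (-1 : ℤ) ^ u * (a : ℤ) ^ x₂ + (-1) ^ v * (b : ℤ) ^ y₂ = r)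
    (hbig : (r : ℝ) / 2 < (a : ℝ) ^ x₁) :
    (x₁ : ℝ) < S + (if a < 5346 then (8.1 + Real.log (Real.log a)) / Real.log a
      else 1.19408) := by
  by_contra! hcon
  obtain ⟨d, hd, hdy, hdvd, habs⟩ :=
    exists_pow_eq_of_two_solutions ha hb hab hr hu hv hne hxle hyle heq₁ heq₂
  have ha0 : (0 : ℝ) < a := by exact_mod_cast (by omega : 0 < a)
  have hb0 : (0 : ℝ) < b := by exact_mod_cast (by omega : 0 < b)
  have hd0 : (0 : ℝ) < d := by exact_mod_cast hd
  have hA : 1.0985 < Real.log a := log_three_gt.trans_le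
    (Real.log_le_log (by norm_num) (by exact_mod_cast ha))
  have hB : 0.69 < Real.log b := by
    have : Real.log 2 ≤ Real.log b := Real.log_le_log (by norm_num) (by exact_mod_cast hb)
    linarith [Real.log_two_gt_d9]
  have hdy' : (d : ℝ) ≤ y₂ := by exact_mod_cast hdy
  have hE := mul_log_le_sum_add_log_of_pow_dvd hb hab hn hg hx₁ hd hdvd
  have hG := two_mul_sum_mul_log_le ha hb hab hn hg
  rw [eq_div_iff (by linarith)] at hS
  rw [← hS] at hE hG
  have hk := mul_le_mul_of_nonneg_right hcon (by linarith : 0 ≤ Real.log a)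
  rw [add_mul] at hk
  obtain ⟨hd1, hd2⟩ := le_of_mul_log_le_log ha hd (by linarith)
  have hY : 3294 * Real.log a ≤ y₂ := hd1.trans hdy'
  have hlow := four_mul_exp_lt_abs_linear_form (X := x₂) (Y := y₂) ha hb hab hY
  have hYB : 0.69 * (y₂ : ℝ) ≤ y₂ * Real.log b := by
    nlinarith only [hB, hdy', hd0]
  have hlogd : Real.log d ≤ 0.005 * (y₂ * Real.log b) := by
    have h1 := Real.log_le_log hd0 hdy'
    have h2 := log_le_log_add_div (hd0.trans_le hdy') (by norm_num : (0 : ℝ) < 4096)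
    rw [show (4096 : ℝ) = 2 ^ 12 by norm_num, Real.log_pow] at h2
    norm_num at h2
    linarith [Real.log_two_lt_d9]
  have hx : x₁ * Real.log a ≤ 0.11 * (y₂ * Real.log b) := by
    have h1 := mul_le_mul_of_nonneg_right (hd2.trans
      (mul_le_mul_of_nonneg_left hdy' (by norm_num))) (by linarith : 0 ≤ Real.log b)
    linarith
  have hbY : (0 : ℝ) < (b : ℝ) ^ y₂ := by positivity
  have hr2 : (r : ℝ) / b ^ y₂ ≤ 2 * Real.exp (-0.89 * (y₂ * Real.log b)) := by
    rw [div_le_iff₀ hbY]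
    have h1 : (b : ℝ) ^ y₂ = Real.exp (y₂ * Real.log b) := by
      rw [mul_comm, ← Real.rpow_def_of_pos hb0, Real.rpow_natCast]
    have h2 : (a : ℝ) ^ x₁ = Real.exp (x₁ * Real.log a) := by
      rw [mul_comm, ← Real.rpow_def_of_pos ha0, Real.rpow_natCast]
    rw [h1, mul_assoc, ← Real.exp_add]
    have h3 := Real.exp_le_exp.2 hx
    rw [show -0.89 * (y₂ * Real.log b) + y₂ * Real.log b = 0.11 * (y₂ * Real.log b) by ring]
    linarith
  have habs' : |(a : ℝ) ^ x₂ / (b : ℝ) ^ y₂ - 1| = r / b ^ y₂ := by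
    rw [div_sub_one hbY.ne', abs_div, abs_of_pos hbY]
    congr 1
    exact_mod_cast habs
  have hsmall : 2 * Real.exp (-0.89 * (y₂ * Real.log b)) ≤ 1 / 2 := by
    have h1 := Real.add_one_le_exp (0.89 * (y₂ * Real.log b))
    rw [show -0.89 * (y₂ * Real.log b) = -(0.89 * (y₂ * Real.log b)) by ring, Real.exp_neg]
    have h2 : (4 : ℝ) ≤ Real.exp (0.89 * (y₂ * Real.log b)) := by linarith
    have h3 := inv_anti₀ (by norm_num) h2
    linarith
  have hq : 1 / 2 ≤ (a : ℝ) ^ x₂ / (b : ℝ) ^ y₂ := by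
    have := neg_abs_le ((a : ℝ) ^ x₂ / (b : ℝ) ^ y₂ - 1)
    linarith
  have hlog := abs_log_le_two_mul_abs_sub_one hq
  rw [Real.log_div (by positivity) hbY.ne', Real.log_pow, Real.log_pow, habs'] at hlog
  linarith
end

section
/- For every nonzero integer d, there is at most one pair (x,y) of positive integers with 7^x − 2^y = d. -/
/-- If `k` is the order of `g` modulo `q`, then `g ^ n ≡ 1` forces `k ∣ n`. -/
theorem dvd_of_pow_modEq_one {g q k n : ℕ} (hk : 0 < k) (h1 : g ^ k % q = 1 % q)
    (hr : ∀ r < k, 0 < r → g ^ r % q ≠ 1 % q) (h : (q : ℤ) ∣ (g : ℤ) ^ n - 1) : k ∣ n := by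
  have h' : 1 ≡ g ^ n [MOD q] := by
    rw [Nat.modEq_iff_dvd]
    push_cast
    exact h
  by_contra hn
  have hpos : 0 < n % k := Nat.pos_of_ne_zero fun h0 => hn (Nat.dvd_of_mod_eq_zero h0)
  refine hr _ (Nat.mod_lt n hk) hpos ?_
  have h2 : g ^ n ≡ 1 ^ (n / k) * g ^ (n % k) [MOD q] := by
    conv_lhs => rw [← Nat.div_add_mod n k, pow_add, pow_mul]
    exact (Nat.ModEq.pow _ h1).mul_right _
  rw [one_pow, one_mul] at h2
  exact (h'.trans h2).symm

theorem four_dvd_and_two_dvd {x y a b : ℕ} (hx : 0 < x)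
    (h : (7 : ℤ) ^ x * (7 ^ a - 1) = 2 ^ y * (2 ^ b - 1)) : 4 ∣ a ∧ 2 ∣ b := by
  have to_two : ∀ q : ℤ, IsCoprime q 2 → q ∣ 7 ^ a - 1 → q ∣ 2 ^ b - 1 := fun q hq hd =>
    (hq.pow_right (n := y)).dvd_of_dvd_mul_left (h ▸ hd.mul_left _)
  have to_seven : ∀ q : ℤ, IsCoprime q 7 → q ∣ 2 ^ b - 1 → q ∣ 7 ^ a - 1 := fun q hq hd =>
    (hq.pow_right (n := x)).dvd_of_dvd_mul_left (h ▸ hd.mul_left _)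
  have hcop : ∀ q r : ℤ, Int.gcd q r = 1 → IsCoprime q r := fun q r => Int.isCoprime_iff_gcd_eq_one.2
  have b3 : 3 ∣ b := by
    refine dvd_of_pow_modEq_one (g := 2) (q := 7) (by norm_num) (by norm_num) (by decide) ?_
    refine ((hcop 7 2 (by norm_num)).pow_right (n := y)).dvd_of_dvd_mul_left ?_
    exact h ▸ (dvd_pow_self (7 : ℤ) hx.ne').mul_right _
  have b2 : 2 ∣ b := by
    refine dvd_of_pow_modEq_one (g := 2) (q := 3) (by norm_num) (by norm_num) (by decide) ?_
    exact to_two 3 (hcop _ _ (by norm_num))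
      (Dvd.dvd.trans (by norm_num) (dvd_pow_sub_one_of_dvd (one_dvd a)))
  have b6 : 6 ∣ b := by omega
  have a3 : 3 ∣ a := by
    refine dvd_of_pow_modEq_one (g := 7) (q := 9) (by norm_num) (by norm_num) (by decide) ?_
    exact to_seven 9 (hcop _ _ (by norm_num)) (Dvd.dvd.trans (by norm_num) (dvd_pow_sub_one_of_dvd b6))
  have b18 : 18 ∣ b := by
    refine dvd_of_pow_modEq_one (g := 2) (q := 19) (by norm_num) (by norm_num) (by decide) ?_
    exact to_two 19 (hcop _ _ (by norm_num)) (Dvd.dvd.trans (by norm_num) (dvd_pow_sub_one_of_dvd a3))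
  have a9 : 9 ∣ a := by
    refine dvd_of_pow_modEq_one (g := 7) (q := 27) (by norm_num) (by norm_num) (by decide) ?_
    exact to_seven 27 (hcop _ _ (by norm_num)) (Dvd.dvd.trans (by norm_num) (dvd_pow_sub_one_of_dvd b18))
  have b36 : 36 ∣ b := by
    refine dvd_of_pow_modEq_one (g := 2) (q := 37) (by norm_num) (by norm_num) (by decide) ?_
    exact to_two 37 (hcop _ _ (by norm_num)) (Dvd.dvd.trans (by norm_num) (dvd_pow_sub_one_of_dvd a9))
  refine ⟨?_, b2⟩
  refine dvd_of_pow_modEq_one (g := 7) (q := 5) (by norm_num) (by norm_num) (by decide) ?_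
  exact to_seven 5 (hcop _ _ (by norm_num)) (Dvd.dvd.trans (by norm_num) (dvd_pow_sub_one_of_dvd b36))

/-- A nondegenerate value of `e A² + D B²` is at least `e + D`. -/
theorem add_le_of_ne_zero {e D A B : ℤ} (he : 0 < e) (hD : 0 < D) (hA : A ≠ 0) (hB : B ≠ 0) :
    e + D ≤ e * A ^ 2 + D * B ^ 2 := by
  have h1 : 1 ≤ A ^ 2 := Int.add_one_le_iff.2 (show 0 < A ^ 2 by positivity)
  have h2 : 1 ≤ B ^ 2 := Int.add_one_le_iff.2 (show 0 < B ^ 2 by positivity)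
  nlinarith

theorem sq_eq_one_of_eq_add {e D A B : ℤ} (he : 0 < e) (hD : 0 < D) (hA : A ≠ 0) (hB : B ≠ 0)
    (h : e * A ^ 2 + D * B ^ 2 = e + D) : A ^ 2 = 1 := by
  have h1 : 1 ≤ A ^ 2 := Int.add_one_le_iff.2 (show 0 < A ^ 2 by positivity)
  have h2 : 1 ≤ B ^ 2 := Int.add_one_le_iff.2 (show 0 < B ^ 2 by positivity)
  nlinarith

/-- If `E + d` is a power of `7` with `E` even, then primitive representations of powers of `7`
by `E a² + d b²` have `a` odd. -/
theorem odd_of_form_eq_seven_pow {E d : ℤ} {x : ℕ} (hE : Even E) (hE0 : 0 < E) (hd : 1 < d)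
    (hd7 : ¬ (7 : ℤ) ∣ d) (hE7 : ¬ (7 : ℤ) ∣ E) (hx : E + d = 7 ^ x) (z : ℕ) :
    ∀ a b : ℤ, E * a ^ 2 + d * b ^ 2 = 7 ^ z → ¬ (7 : ℤ) ∣ a → Odd a := by
  have p7 : Prime (7 : ℤ) := by norm_num
  have odd7 : ∀ k : ℕ, Odd ((7 : ℤ) ^ k) := fun k => Odd.pow (by decide)
  have hx0 : x ≠ 0 := by
    rintro rfl
    rw [pow_zero] at hx
    omega
  have b_ne : ∀ (a b : ℤ) (k : ℕ), E * a ^ 2 + d * b ^ 2 = 7 ^ k → b ≠ 0 := by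
    rintro a b k h rfl
    have := odd7 k
    rw [← h] at this
    exact Int.not_odd_iff_even.2 (by simpa using hE.mul_right (a ^ 2)) this
  have a_ne : ∀ (a b : ℤ) (k : ℕ), E * a ^ 2 + d * b ^ 2 = 7 ^ k → a ≠ 0 := by
    rintro a b k h rfl
    have h1 : d ∣ 7 ^ k := ⟨b ^ 2, by linarith⟩
    have h2 : IsCoprime d (7 ^ k) := ((p7.coprime_iff_not_dvd.2 hd7).symm).pow_right
    have h3 := h2.isUnit_of_dvd' dvd_rfl h1
    rcases Int.isUnit_iff.1 h3 with h | h <;> omega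
  have le_of : ∀ (a b : ℤ) (k : ℕ), E * a ^ 2 + d * b ^ 2 = 7 ^ k → x ≤ k := by
    intro a b k h
    have h1 := add_le_of_ne_zero hE0 (by linarith : 0 < d) (a_ne a b k h) (b_ne a b k h)
    rw [h, hx] at h1
    exact (pow_le_pow_iff_right₀ (by norm_num)).1 h1
  induction z using Nat.strong_induction_on with
  | _ z ih =>
  intro a b hab ha
  obtain ⟨l, rfl⟩ := Nat.exists_eq_add_of_le (le_of a b z hab)
  wlog hs : (7 : ℤ) ^ x ∣ a - b generalizing b with H
  · refine H (-b) (by rw [← hab]; ring) ?_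
    have h1 : (7 : ℤ) ^ x ∣ E * ((a - b) * (a + b)) := by
      rw [show E * ((a - b) * (a + b)) = 7 ^ (x + l) - b ^ 2 * 7 ^ x by rw [← hab, ← hx]; ring]
      exact dvd_sub (pow_dvd_pow _ (by omega)) (dvd_mul_left _ _)
    have h2 := p7.pow_dvd_of_dvd_mul_left _ hE7 h1
    rw [sub_neg_eq_add]
    by_cases h3 : (7 : ℤ) ∣ a - b
    · refine absurd (p7.pow_dvd_of_dvd_mul_right _ (fun h4 => ha ?_) h2) hs
      have h5 : (7 : ℤ) ∣ 2 * a := by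
        have := dvd_add h3 h4
        rwa [show a - b + (a + b) = 2 * a by ring] at this
      omega
    · exact p7.pow_dvd_of_dvd_mul_left _ h3 h2
  obtain ⟨q', hq'⟩ := hs
  obtain ⟨q, rfl⟩ : ∃ q, q' = -q := ⟨-q', by ring⟩
  have hb : b = a + (E + d) * q := by rw [hx]; linarith
  have h7 : (7 : ℤ) ^ x ≠ 0 := by positivity
  have hpq : (a + d * q) ^ 2 + E * d * q ^ 2 = 7 ^ l := by
    refine mul_left_cancel₀ h7 ?_
    rw [← pow_add, ← hab, hb, ← hx]
    ring
  rcases Nat.eq_zero_or_pos l with rfl | hl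
  · have h1 := sq_eq_one_of_eq_add hE0 (by linarith : 0 < d) (a_ne a b _ hab) (b_ne a b _ hab)
      (by rw [hab, hx]; simp)
    exact (Int.odd_pow' two_ne_zero).1 (h1 ▸ odd_one)
  have hb7 : ¬ (7 : ℤ) ∣ b := by
    intro h
    have h1 : (7 : ℤ) ∣ E * a ^ 2 := by
      rw [show E * a ^ 2 = 7 ^ (x + l) - d * b * b by rw [← hab]; ring]
      exact dvd_sub (dvd_pow_self _ (by omega)) (h.mul_left _)
    exact ha (p7.dvd_of_dvd_pow ((p7.dvd_or_dvd h1).resolve_left hE7))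
  have hdiv : ∀ m, m ≤ x → m ≤ l → (7 : ℤ) ^ m ∣ a + 2 * d * q ∧
      (7 : ℤ) ^ m ∣ q * E - a - d * q := by
    intro m hm1 hm2
    have e1 : (7 : ℤ) ^ m ∣ 7 ^ x := pow_dvd_pow _ hm1
    have e2 : (7 : ℤ) ^ m ∣ 7 ^ l := pow_dvd_pow _ hm2
    constructor
    · refine p7.pow_dvd_of_dvd_mul_left _ ha ?_
      rw [show a * (a + 2 * d * q) = 7 ^ l - d * q ^ 2 * 7 ^ x by rw [← hpq, ← hx]; ring]
      exact dvd_sub e2 (e1.mul_left _)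
    · refine p7.pow_dvd_of_dvd_mul_left _ hb7 ?_
      rw [show b * (q * E - a - d * q) = q ^ 2 * E * 7 ^ x - 7 ^ l by rw [← hpq, ← hx, hb]; ring]
      exact dvd_sub (e1.mul_left _) e2
  have hnorm : E * (a + 2 * d * q) ^ 2 + d * (q * E - a - d * q) ^ 2 = 7 ^ x * 7 ^ l := by
    rw [← hpq, ← hx]; ring
  rcases le_or_gt l x with hlx | hlx
  · exfalso
    obtain ⟨⟨a', ha'⟩, ⟨b', hb'⟩⟩ := hdiv l hlx le_rfl
    obtain ⟨r, rfl⟩ := Nat.exists_eq_add_of_le hlx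
    have h1 : E * a' ^ 2 + d * b' ^ 2 = 7 ^ r := by
      have h0 : ((7 : ℤ) ^ l) ^ 2 ≠ 0 := by positivity
      refine mul_left_cancel₀ h0 ?_
      rw [ha', hb', pow_add] at hnorm
      linear_combination hnorm
    have := le_of _ _ _ h1
    omega
  · obtain ⟨⟨a', ha'⟩, ⟨b', hb'⟩⟩ := hdiv x le_rfl hlx.le
    obtain ⟨r, rfl⟩ := Nat.exists_eq_add_of_le hlx.le
    have h1 : E * a' ^ 2 + d * b' ^ 2 = 7 ^ r := by
      have h0 : ((7 : ℤ) ^ x) ^ 2 ≠ 0 := by positivity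
      refine mul_left_cancel₀ h0 ?_
      rw [ha', hb', pow_add] at hnorm
      linear_combination hnorm
    have hq : q = a' + b' := by
      refine mul_left_cancel₀ h7 ?_
      rw [mul_add, ← ha', ← hb', ← hx]; ring
    have hp : a + d * q = E * a' - d * b' := by
      refine mul_left_cancel₀ h7 ?_
      rw [show (7 : ℤ) ^ x * (E * a' - d * b') = E * (7 ^ x * a') - d * (7 ^ x * b') by ring,
        ← ha', ← hb', ← hx]
      ring
    have hr : 0 < r := by omega
    have h2 : ¬ (7 : ℤ) ∣ a' := by
      intro h
      have h3 : (7 : ℤ) ∣ d * b' ^ 2 := by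
        rw [show d * b' ^ 2 = 7 ^ r - E * a' * a' by rw [← h1]; ring]
        exact dvd_sub (dvd_pow_self _ hr.ne') (h.mul_left _)
      have h4 := p7.dvd_of_dvd_pow ((p7.dvd_or_dvd h3).resolve_left hd7)
      refine ha ?_
      rw [show a = (E - d) * a' - 2 * d * b' by rw [hq] at hp; linear_combination hp]
      exact dvd_sub (h.mul_left _) (h4.mul_left _)
    have h3 := (odd7 x).mul (ih r (by omega) a' b' h1 h2)
    rw [← ha', show a + 2 * d * q = a + 2 * (d * q) by ring] at h3
    simpa [parity_simps] using h3

/-- The coefficients of `(√e + √(-D)) ^ (2 i + 1) = cᵢ √e + bᵢ √(-D)`. -/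
def oddPowCoeff (e D : ℤ) : ℕ → ℤ × ℤ
  | 0 => (1, 1)
  | i + 1 => ((e - D) * (oddPowCoeff e D i).1 - 2 * D * (oddPowCoeff e D i).2,
      (e - D) * (oddPowCoeff e D i).2 + 2 * e * (oddPowCoeff e D i).1)

/-- If `e + D` is a power of `2`, then odd representations of powers of `2` by `e A² + D B²`
come from odd powers of `(√e + √(-D)) / 2`. -/
theorem exists_oddPowCoeff {e D : ℤ} {n : ℕ} (he : Odd e) (hD : Odd D) (he4 : 4 < e) (hD4 : 4 < D)
    (hn : e + D = 2 ^ (n + 2)) (m : ℕ) :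
    ∀ A B : ℤ, e * A ^ 2 + D * B ^ 2 = 2 ^ (m + 2) → Odd A → Odd B → (2 : ℤ) ^ (n + 1) ∣ A - B →
      ∃ (i : ℕ) (s : ℤ), s ^ 2 = 1 ∧ A * 4 ^ i = s * (oddPowCoeff e D i).1 ∧
        B * 4 ^ i = s * (oddPowCoeff e D i).2 := by
  have p2 : Prime (2 : ℤ) := Int.prime_two
  have ndvd : ∀ k : ℤ, Odd k → ¬ (2 : ℤ) ∣ k := fun k hk => by
    rwa [← even_iff_two_dvd, Int.not_even_iff_odd]
  have not_dvd_pow : ∀ (k : ℤ) (r : ℕ), Odd k → 4 < k → ¬ k ∣ 2 ^ r := by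
    intro k r hk h4 h1
    have h2 : IsCoprime k (2 ^ r) := ((p2.coprime_iff_not_dvd.2 (ndvd k hk)).symm).pow_right
    rcases Int.isUnit_iff.1 (h2.isUnit_of_dvd' dvd_rfl h1) with h | h <;> omega
  have hn0 : n ≠ 0 := by
    rintro rfl
    rw [zero_add] at hn
    omega
  have le_of : ∀ (a b : ℤ) (k : ℕ), e * a ^ 2 + D * b ^ 2 = 2 ^ (k + 2) → n ≤ k := by
    intro a b k h
    have ha : a ≠ 0 := by
      rintro rfl
      exact not_dvd_pow D (k + 2) hD hD4 ⟨b ^ 2, by linarith⟩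
    have hb : b ≠ 0 := by
      rintro rfl
      exact not_dvd_pow e (k + 2) he he4 ⟨a ^ 2, by linarith⟩
    have h1 := add_le_of_ne_zero (by linarith : 0 < e) (by linarith : 0 < D) ha hb
    rw [h, hn] at h1
    have := (pow_le_pow_iff_right₀ (by norm_num)).1 h1
    omega
  induction m using Nat.strong_induction_on with
  | _ m ih =>
  intro A B hAB hA hB hs
  obtain ⟨l, rfl⟩ := Nat.exists_eq_add_of_le (le_of A B m hAB)
  obtain ⟨q', hq'⟩ := hs
  obtain ⟨q, rfl⟩ : ∃ q, q' = -q := ⟨-q', by ring⟩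
  have hn' : (2 : ℤ) ^ (n + 1) * 2 = e + D := by rw [hn]; ring
  have hb2 : 2 * B = 2 * A + (e + D) * q := by rw [← hn']; linarith
  have hpos : (2 : ℤ) ^ (n + 2) ≠ 0 := by positivity
  obtain ⟨p, hp⟩ : ∃ p, p = 2 * A + q * D := ⟨_, rfl⟩
  have hpB : p = 2 * B - q * e := by rw [hp, hb2]; ring
  have hpq : p ^ 2 + e * D * q ^ 2 = 2 ^ (l + 2) := by
    refine mul_left_cancel₀ hpos ?_
    have h1 : (2 : ℤ) ^ (n + 2) * 2 ^ (l + 2) = e * (2 * A) ^ 2 + D * (2 * B) ^ 2 := by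
      rw [show (2 : ℤ) ^ (n + 2) * 2 ^ (l + 2) = 4 * 2 ^ (n + l + 2) by ring, ← hAB]; ring
    rw [h1, hb2, hp, ← hn]
    ring
  rcases Nat.eq_zero_or_pos l with rfl | hl
  · have hq : q = 0 := by
      by_contra h
      have h1 : 1 ≤ q ^ 2 := Int.add_one_le_iff.2 (show 0 < q ^ 2 by positivity)
      have h2 : 4 * 4 < e * D := mul_lt_mul'' he4 hD4 (by norm_num) (by norm_num)
      have h3 : e * D * 1 ≤ e * D * q ^ 2 := mul_le_mul_of_nonneg_left h1 (by linarith)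
      rw [zero_add] at hpq
      linarith [sq_nonneg p]
    have hBA : B = A := by rw [hq] at hb2; linarith
    refine ⟨0, A, ?_, by simp [oddPowCoeff], by simp [oddPowCoeff, hBA]⟩
    rw [hBA, ← add_mul, hn] at hAB
    exact mul_left_cancel₀ hpos (by simpa using hAB)
  have hdiv : ∀ k, k ≤ n → k ≤ l → (2 : ℤ) ^ (k + 1) ∣ p + q * D ∧
      (2 : ℤ) ^ (k + 1) ∣ q * e - p := by
    intro k hk1 hk2
    have e1 : (2 : ℤ) ^ (k + 2) ∣ 2 ^ (n + 2) := pow_dvd_pow _ (by omega)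
    have e2 : (2 : ℤ) ^ (k + 2) ∣ 2 ^ (l + 2) := pow_dvd_pow _ (by omega)
    have e3 : (2 : ℤ) ^ (k + 2) = 2 * 2 ^ (k + 1) := by ring
    constructor
    · refine p2.pow_dvd_of_dvd_mul_left _ (ndvd A hA) ?_
      refine (mul_dvd_mul_iff_left (two_ne_zero (α := ℤ))).1 ?_
      rw [← e3, show 2 * (A * (p + q * D)) = 2 ^ (l + 2) - D * q ^ 2 * 2 ^ (n + 2) by
        rw [← hpq, ← hn, hp]; ring]
      exact dvd_sub e2 (e1.mul_left _)
    · refine p2.pow_dvd_of_dvd_mul_left _ (ndvd B hB) ?_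
      refine (mul_dvd_mul_iff_left (two_ne_zero (α := ℤ))).1 ?_
      rw [← e3, show 2 * (B * (q * e - p)) = q ^ 2 * e * 2 ^ (n + 2) - 2 ^ (l + 2) by
        rw [← hpq, ← hn, hpB]; ring]
      exact dvd_sub (e1.mul_left _) e2
  have hnorm : e * (p + q * D) ^ 2 + D * (q * e - p) ^ 2 = 2 ^ (n + 2) * 2 ^ (l + 2) := by
    rw [← hpq, ← hn]; ring
  rcases le_or_gt l n with hln | hln
  · exfalso
    obtain ⟨⟨a, ha⟩, ⟨b, hb⟩⟩ := hdiv l hln le_rfl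
    obtain ⟨r, rfl⟩ := Nat.exists_eq_add_of_le hln
    have h1 : e * a ^ 2 + D * b ^ 2 = 2 ^ (r + 2) := by
      have h0 : ((2 : ℤ) ^ (l + 1)) ^ 2 ≠ 0 := by positivity
      refine mul_left_cancel₀ h0 ?_
      rw [ha, hb] at hnorm
      linear_combination hnorm
    have := le_of _ _ _ h1
    omega
  obtain ⟨⟨a, ha⟩, ⟨b, hb⟩⟩ := hdiv n le_rfl hln.le
  obtain ⟨r, rfl⟩ := Nat.exists_eq_add_of_le hln.le
  have h1 : e * a ^ 2 + D * b ^ 2 = 2 ^ (r + 2) := by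
    have h0 : ((2 : ℤ) ^ (n + 1)) ^ 2 ≠ 0 := by positivity
    refine mul_left_cancel₀ h0 ?_
    rw [ha, hb] at hnorm
    linear_combination hnorm
  have h0 : (2 : ℤ) ^ (n + 1) ≠ 0 := by positivity
  have habq : a + b = 2 * q := by
    refine mul_left_cancel₀ h0 ?_
    rw [mul_add, ← ha, ← hb, ← mul_assoc, hn']; ring
  have habp : e * a - D * b = 2 * p := by
    refine mul_left_cancel₀ h0 ?_
    rw [show (2 : ℤ) ^ (n + 1) * (e * a - D * b)
      = e * (2 ^ (n + 1) * a) - D * (2 ^ (n + 1) * b) by ring, ← ha, ← hb, ← mul_assoc, hn']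
    ring
  have hqodd : Odd q := by
    by_contra hq
    rw [Int.not_odd_iff_even, even_iff_two_dvd] at hq
    obtain ⟨q₁, rfl⟩ := hq
    have h2 : (A + q₁ * D) ^ 2 + e * D * q₁ ^ 2 = 2 * 2 ^ (n + r - 1) := by
      rw [← pow_succ', Nat.sub_add_cancel hl]
      refine mul_left_cancel₀ (four_ne_zero (α := ℤ)) ?_
      rw [show (4 : ℤ) * 2 ^ (n + r) = 2 ^ (n + r + 2) by ring, ← hpq, hp]; ring
    have h3 : Even ((A + q₁ * D) ^ 2 + e * D * q₁ ^ 2) := h2 ▸ even_two_mul _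
    have he' := Int.not_even_iff_odd.2 he
    have hD' := Int.not_even_iff_odd.2 hD
    have hA' := Int.not_even_iff_odd.2 hA
    simp only [Int.even_add, Int.even_mul, Int.even_pow, he', hD', hA'] at h3
    tauto
  have haodd : Odd a := by
    by_contra hae
    rw [Int.not_odd_iff_even, even_iff_two_dvd] at hae
    obtain ⟨a₁, rfl⟩ := hae
    obtain ⟨b₁, rfl⟩ : ∃ b₁, b = 2 * b₁ := ⟨q - a₁, by linarith⟩
    have hr : 0 < r := by omega
    have h2 : e * a₁ ^ 2 + D * b₁ ^ 2 = 2 * 2 ^ (r - 1) := by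
      rw [← pow_succ', Nat.sub_add_cancel hr]
      refine mul_left_cancel₀ (four_ne_zero (α := ℤ)) ?_
      rw [show (4 : ℤ) * 2 ^ r = 2 ^ (r + 2) by ring, ← h1]; ring
    have h3 : Even (e * a₁ ^ 2 + D * b₁ ^ 2) := h2 ▸ even_two_mul _
    have h4 : q = a₁ + b₁ := by linarith
    have he' := Int.not_even_iff_odd.2 he
    have hD' := Int.not_even_iff_odd.2 hD
    have hq' := Int.not_even_iff_odd.2 hqodd
    rw [h4] at hq'
    simp only [Int.even_add, Int.even_mul, Int.even_pow, he', hD'] at h3 hq'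
    tauto
  have hbodd : Odd b := by
    rw [show b = 2 * q - a by linarith]
    exact (even_two_mul q).sub_odd haodd
  have hdvd : (2 : ℤ) ^ (n + 1) ∣ a - b := by
    refine p2.pow_dvd_of_dvd_mul_left _ (ndvd D hD) ?_
    refine p2.pow_dvd_of_dvd_mul_left _ (ndvd q hqodd) ?_
    refine (mul_dvd_mul_iff_left (two_ne_zero (α := ℤ))).1 ?_
    rw [show (2 : ℤ) * 2 ^ (n + 1) = 2 ^ (n + 2) by ring,
      show 2 * (q * (D * (a - b))) = a ^ 2 * 2 ^ (n + 2) - 2 ^ (r + 2) by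
        rw [← h1, ← hn]; linear_combination (-D * (a - b)) * habq]
    have := le_of a b r h1
    exact dvd_sub (dvd_mul_left _ _) (pow_dvd_pow _ (by omega))
  obtain ⟨i, s, hs1, hsA, hsB⟩ := ih r (by omega) a b h1 haodd hbodd hdvd
  have hA4 : 4 * A = (e - D) * a - 2 * D * b := by
    linear_combination (-2) * hp - habp + D * habq
  have hB4 : 4 * B = (e - D) * b + 2 * e * a := by
    linear_combination (-2) * hpB - habp - e * habq
  refine ⟨i + 1, s, hs1, ?_, ?_⟩
  · simp only [oddPowCoeff]
    rw [pow_succ]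
    linear_combination 4 ^ i * hA4 + (e - D) * hsA - 2 * D * hsB
  · simp only [oddPowCoeff]
    rw [pow_succ]
    linear_combination 4 ^ i * hB4 + (e - D) * hsB + 2 * e * hsA

theorem oddPowCoeff_modEq {p e D : ℤ} (he : p ∣ e) (i : ℕ) :
    p ∣ (oddPowCoeff e D i).1 - (-D) ^ i * (2 * i + 1) ∧ p ∣ (oddPowCoeff e D i).2 - (-D) ^ i := by
  obtain ⟨w, rfl⟩ := he
  induction i with
  | zero => simp [oddPowCoeff]
  | succ i ih =>
    obtain ⟨⟨c, hc⟩, ⟨b, hb⟩⟩ := ih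
    constructor
    · refine ⟨w * (oddPowCoeff (p * w) D i).1 - D * c - 2 * D * b, ?_⟩
      simp only [oddPowCoeff]
      push_cast
      linear_combination (-D) * hc - 2 * D * hb
    · refine ⟨w * (oddPowCoeff (p * w) D i).2 - D * b + 2 * w * (oddPowCoeff (p * w) D i).1, ?_⟩
      simp only [oddPowCoeff]
      linear_combination (-D) * hb

theorem oddPowCoeff_three (e D : ℤ) : oddPowCoeff e D 3 =
    (e ^ 3 - 21 * e ^ 2 * D + 35 * e * D ^ 2 - 7 * D ^ 3,
      7 * e ^ 3 - 35 * e ^ 2 * D + 21 * e * D ^ 2 - D ^ 3) := by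
  ext <;> simp only [oddPowCoeff] <;> ring

theorem oddPowCoeff_three_dvd (e D : ℤ) (j : ℕ) :
    (oddPowCoeff e D 3).1 ∣ (oddPowCoeff e D (7 * j + 3)).1 ∧
      (oddPowCoeff e D 3).2 ∣ (oddPowCoeff e D (7 * j + 3)).2 := by
  induction j with
  | zero => simp
  | succ j ih =>
    obtain ⟨⟨c, hc⟩, ⟨b, hb⟩⟩ := ih
    have hstep : ∀ i, (oddPowCoeff e D (i + 7)).1
        = (e * (oddPowCoeff e D 3).1 ^ 2 - D * (oddPowCoeff e D 3).2 ^ 2) * (oddPowCoeff e D i).1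
          - 2 * D * (oddPowCoeff e D 3).1 * (oddPowCoeff e D 3).2 * (oddPowCoeff e D i).2 ∧
        (oddPowCoeff e D (i + 7)).2
        = (e * (oddPowCoeff e D 3).1 ^ 2 - D * (oddPowCoeff e D 3).2 ^ 2) * (oddPowCoeff e D i).2
          + 2 * e * (oddPowCoeff e D 3).1 * (oddPowCoeff e D 3).2 * (oddPowCoeff e D i).1 := by
      intro i
      rw [oddPowCoeff_three]
      simp only [oddPowCoeff]
      constructor <;> ring
    rw [show 7 * (j + 1) + 3 = 7 * j + 3 + 7 by ring, (hstep _).1, (hstep _).2]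
    constructor
    · refine ⟨(e * (oddPowCoeff e D 3).1 ^ 2 - D * (oddPowCoeff e D 3).2 ^ 2) * c
        - 2 * D * (oddPowCoeff e D 3).2 * (oddPowCoeff e D (7 * j + 3)).2, ?_⟩
      linear_combination (e * (oddPowCoeff e D 3).1 ^ 2 - D * (oddPowCoeff e D 3).2 ^ 2) * hc
    · refine ⟨(e * (oddPowCoeff e D 3).1 ^ 2 - D * (oddPowCoeff e D 3).2 ^ 2) * b
        + 2 * e * (oddPowCoeff e D 3).1 * (oddPowCoeff e D (7 * j + 3)).1, ?_⟩
      linear_combination (e * (oddPowCoeff e D 3).1 ^ 2 - D * (oddPowCoeff e D 3).2 ^ 2) * hb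

/-- If `7 ^ x + D` and `7 ^ (x + 2 t) + D` are powers of `2` with `D > 4`, then `t = 0`. -/
theorem seven_pow_add_ne_two_pow {D : ℤ} {x n t m : ℕ} (hx : 0 < x) (ht : 0 < t)
    (hD4 : 4 < D) (h1 : 7 ^ x + D = 2 ^ (n + 2)) (h2 : 7 ^ (x + 2 * t) + D = 2 ^ (m + 2)) :
    False := by
  have p7 : Prime (7 : ℤ) := by norm_num
  have p2 : Prime (2 : ℤ) := Int.prime_two
  have odd7 : ∀ k : ℕ, Odd ((7 : ℤ) ^ k) := fun k => Odd.pow (by decide)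
  have n7 : ∀ k : ℕ, ¬ (7 : ℤ) ∣ 2 ^ k := fun k h => by
    have := p7.dvd_of_dvd_pow h
    omega
  have h7x : (7 : ℤ) ∣ 7 ^ x := dvd_pow_self _ hx.ne'
  have hx7 : (7 : ℤ) ≤ 7 ^ x := Int.le_of_dvd (by positivity) h7x
  have hn0 : n ≠ 0 := by
    rintro rfl
    rw [zero_add] at h1
    omega
  have hDodd : Odd D := by
    rw [show D = 2 * 2 ^ (n + 1) - 7 ^ x by rw [← pow_succ', ← h1]; ring]
    exact (even_two_mul _).sub_odd (odd7 x)
  have hD7 : ¬ (7 : ℤ) ∣ D := fun h => n7 _ (h1 ▸ dvd_add h7x h)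
  have hform : ∀ B : ℤ, B ^ 2 = 1 → (7 : ℤ) ^ x * (7 ^ t) ^ 2 + D * B ^ 2 = 2 ^ (m + 2) := by
    intro B hB
    rw [hB, ← h2]
    ring
  have hnm : n ≤ m := by
    have h3 : (2 : ℤ) ^ (n + 2) ≤ 2 ^ (m + 2) := by
      rw [← h1, ← h2]
      gcongr <;> omega
    have := (pow_le_pow_iff_right₀ (by norm_num)).1 h3
    omega
  obtain ⟨B, hB1, hB2⟩ : ∃ B : ℤ, B ^ 2 = 1 ∧ (2 : ℤ) ^ (n + 1) ∣ 7 ^ t - B := by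
    have h3 : (2 : ℤ) ^ (n + 2) ∣ 7 ^ x * ((7 ^ t - 1) * (7 ^ t + 1)) := by
      rw [show (7 : ℤ) ^ x * ((7 ^ t - 1) * (7 ^ t + 1)) = 2 ^ (m + 2) - 2 ^ (n + 2) by
        rw [← h1, ← h2]; ring]
      exact dvd_sub (pow_dvd_pow _ (by omega)) dvd_rfl
    have h4 := (Int.isCoprime_iff_gcd_eq_one.2 (by norm_num) : IsCoprime (2 : ℤ) 7).pow
      (m := n + 2) (n := x) |>.dvd_of_dvd_mul_left h3
    obtain ⟨k, hk⟩ := odd7 t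
    rw [hk, show (2 * k + 1 - 1) * (2 * k + 1 + 1) = 2 * (2 * (k * (k + 1))) by ring,
      pow_succ', mul_dvd_mul_iff_left two_ne_zero, pow_succ',
      mul_dvd_mul_iff_left two_ne_zero] at h4
    rcases Int.even_or_odd k with hk' | hk'
    · refine ⟨1, by norm_num, ?_⟩
      rw [hk, add_sub_cancel_right, pow_succ', mul_dvd_mul_iff_left two_ne_zero]
      refine p2.pow_dvd_of_dvd_mul_right _ ?_ h4
      rw [← even_iff_two_dvd, Int.not_even_iff_odd]
      exact hk'.add_one
    · refine ⟨-1, by norm_num, ?_⟩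
      rw [hk, show 2 * k + 1 - -1 = 2 * (k + 1) by ring, pow_succ',
        mul_dvd_mul_iff_left two_ne_zero]
      refine p2.pow_dvd_of_dvd_mul_left _ ?_ h4
      rwa [← even_iff_two_dvd, Int.not_even_iff_odd]
  have hBodd : Odd B := (Int.odd_pow' two_ne_zero).1 (hB1 ▸ odd_one)
  obtain ⟨i, s, hs, hA, hB⟩ := exists_oddPowCoeff (odd7 x) hDodd (by linarith) hD4 h1 m (7 ^ t) B
    (hform B hB1) (odd7 t) hBodd hB2
  have hA' : (oddPowCoeff (7 ^ x) D i).1 * s = 7 ^ t * 4 ^ i := by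
    rw [hA]; ring
  have hc : (oddPowCoeff (7 ^ x) D i).1 ∣ 7 ^ t * 4 ^ i := ⟨s, hA'.symm⟩
  have hb : (oddPowCoeff (7 ^ x) D i).2 ∣ 4 ^ i := by
    refine ⟨s * B, ?_⟩
    linear_combination (-4 ^ i) * hB1 + B * hB
  have hi : (7 : ℤ) ∣ 2 * i + 1 := by
    have h3 : (7 : ℤ) ∣ (oddPowCoeff (7 ^ x) D i).1 := by
      rw [show (oddPowCoeff (7 ^ x) D i).1 = s * (7 ^ t * 4 ^ i) by
        linear_combination (-s) * hA - (oddPowCoeff (7 ^ x) D i).1 * hs]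
      exact ((dvd_pow_self _ ht.ne').mul_right _).mul_left _
    have h4 := (dvd_sub_right h3).1 (oddPowCoeff_modEq h7x i).1
    refine (p7.dvd_or_dvd h4).resolve_left fun h => hD7 ?_
    exact (dvd_neg.1 (p7.dvd_of_dvd_pow h))
  obtain ⟨j, rfl⟩ : ∃ j, i = 7 * j + 3 := ⟨i / 7, by omega⟩
  have hc3 := (oddPowCoeff_three_dvd (7 ^ x) D j).1.trans hc
  have hb3 := (oddPowCoeff_three_dvd (7 ^ x) D j).2.trans hb
  obtain ⟨w, hw⟩ := h7x
  obtain ⟨N, hN⟩ : ∃ N : ℤ, N = 2 ^ n := ⟨_, rfl⟩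
  have hDN : D = 4 * N - 7 * w := by
    rw [← hw, hN, show (4 : ℤ) * 2 ^ n = 2 ^ (n + 2) by ring, ← h1]; ring
  have hwodd : Odd w := by
    have := odd7 x
    rw [hw, Int.odd_mul] at this
    exact this.2
  have hNeven : Even N := by rw [hN]; exact (Int.even_pow.2 ⟨even_two, hn0⟩)
  have unit_of : ∀ k : ℤ, Odd k → ¬ (7 : ℤ) ∣ k → k ∣ 7 ^ t * 4 ^ (7 * j + 3) → k ^ 2 = 1 := by
    intro k hk hk7 h
    have e1 : IsCoprime k (7 ^ t) := (p7.coprime_iff_not_dvd.2 hk7).symm.pow_right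
    have e2 : IsCoprime k (4 ^ (7 * j + 3)) := by
      refine IsCoprime.pow_right ?_
      rw [show (4 : ℤ) = 2 ^ 2 by norm_num]
      refine (p2.coprime_iff_not_dvd.2 ?_).symm.pow_right
      rwa [← even_iff_two_dvd, Int.not_even_iff_odd]
    rcases Int.isUnit_iff.1 ((e1.mul_right e2).isUnit_of_dvd' dvd_rfl h) with h | h <;>
      rw [h] <;> norm_num
  have hc_eq : (oddPowCoeff (7 ^ x) D 3).1
      = 448 * (49 * w ^ 3 - 49 * N * w ^ 2 + 14 * N ^ 2 * w - N ^ 3) := by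
    rw [oddPowCoeff_three, hDN, hw]; ring
  have hb_eq : (oddPowCoeff (7 ^ x) D 3).2
      = -64 * (D ^ 3 - 7 * N * D ^ 2 + 14 * N ^ 2 * D - 7 * N ^ 3) := by
    rw [oddPowCoeff_three, show (7 : ℤ) ^ x = 4 * N - D by rw [hDN, hw]; ring]; ring
  have hM : (49 * w ^ 3 - 49 * N * w ^ 2 + 14 * N ^ 2 * w - N ^ 3) ^ 2 = 1 := by
    refine unit_of _ ?_ ?_ (Dvd.dvd.trans ⟨448, by rw [hc_eq]; ring⟩ hc3)
    · have := Int.not_even_iff_odd.2 hwodd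
      rw [← Int.not_even_iff_odd]
      simp [Int.even_add, Int.even_sub, Int.even_mul, Int.even_pow, hNeven, this,
        show ¬ Even (49 : ℤ) by decide]
    · intro h
      refine n7 n (hN ▸ p7.dvd_of_dvd_pow (n := 3) ?_)
      have h3 : (7 : ℤ) ∣ 7 * (7 * w ^ 3 - 7 * N * w ^ 2 + 2 * N ^ 2 * w) := dvd_mul_right _ _
      have h4 := dvd_sub h3 h
      ring_nf at h4
      exact h4
  have hL : (D ^ 3 - 7 * N * D ^ 2 + 14 * N ^ 2 * D - 7 * N ^ 3) ^ 2 = 1 := by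
    refine unit_of _ ?_ ?_ (Dvd.dvd.trans ⟨-64, by rw [hb_eq]; ring⟩ (hb3.mul_left _))
    · have := Int.not_even_iff_odd.2 hDodd
      rw [← Int.not_even_iff_odd]
      simp [Int.even_add, Int.even_sub, Int.even_pow, hNeven, this]
    · intro h
      refine hD7 (p7.dvd_of_dvd_pow (n := 3) ?_)
      have h3 : (7 : ℤ) ∣ 7 * (N * D ^ 2 - 2 * N ^ 2 * D + N ^ 3) := dvd_mul_right _ _
      have h4 := dvd_add h3 h
      ring_nf at h4
      exact h4
  have hfinal : 7 * w * 49 + D = 4 * N ^ 7 := by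
    have h3 : 7 * w * 49 * (49 * w ^ 3 - 49 * N * w ^ 2 + 14 * N ^ 2 * w - N ^ 3) ^ 2
        + D * (D ^ 3 - 7 * N * D ^ 2 + 14 * N ^ 2 * D - 7 * N ^ 3) ^ 2 = 4 * N ^ 7 := by
      rw [hDN]; ring
    rw [hM, hL] at h3
    linarith
  have hN2 : 2 ≤ N := by
    have := le_self_pow₀ (one_le_two (α := ℤ)) hn0
    rwa [hN]
  have h64 : (2 : ℤ) ^ 6 ≤ N ^ 6 := by gcongr
  nlinarith

theorem seven_two_pillai (d : ℤ) (hd : d ≠ 0) :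
    ∀ x₁ y₁ x₂ y₂ : ℕ, 0 < x₁ → 0 < y₁ → 0 < x₂ → 0 < y₂ →
      (7 : ℤ) ^ x₁ - 2 ^ y₁ = d → (7 : ℤ) ^ x₂ - 2 ^ y₂ = d → (x₁, y₁) = (x₂, y₂) := by
  intro x₁ y₁ x₂ y₂ hx₁ hy₁ hx₂ hy₂ h₁ h₂
  wlog hle : x₁ ≤ x₂ generalizing x₁ y₁ x₂ y₂ with H
  · exact (H x₂ y₂ x₁ y₁ hx₂ hy₂ hx₁ hy₁ h₂ h₁ (le_of_not_ge hle)).symm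
  rcases hle.eq_or_lt with rfl | hlt
  · have h3 : (2 : ℤ) ^ y₁ = 2 ^ y₂ := by linarith
    rw [pow_right_injective₀ (by norm_num) (by norm_num) h3]
  exfalso
  have hpow : (7 : ℤ) ^ x₁ < 7 ^ x₂ := pow_lt_pow_right₀ (by norm_num) hlt
  have hylt : y₁ < y₂ := by
    have h3 : (2 : ℤ) ^ y₁ < 2 ^ y₂ := by linarith
    exact (pow_lt_pow_iff_right₀ (by norm_num)).1 h3
  obtain ⟨a, rfl⟩ := Nat.exists_eq_add_of_lt hlt
  obtain ⟨b, rfl⟩ := Nat.exists_eq_add_of_lt hylt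
  rw [add_assoc] at h₂
  have heq : (7 : ℤ) ^ x₁ * (7 ^ (a + 1) - 1) = 2 ^ y₁ * (2 ^ (b + 1) - 1) := by
    rw [mul_sub, mul_sub, ← pow_add, ← pow_add, ← add_assoc y₁]
    linarith
  obtain ⟨ha, hb⟩ := four_dvd_and_two_dvd hx₁ heq
  obtain ⟨t, hat⟩ : ∃ t, a + 1 = 2 * t := ⟨(a + 1) / 2, by omega⟩
  obtain ⟨u, hbu⟩ := hb
  have p7 : Prime (7 : ℤ) := by norm_num
  have n7 : ∀ k : ℕ, ¬ (7 : ℤ) ∣ 2 ^ k := fun k h => by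
    have := p7.dvd_of_dvd_pow h
    omega
  rcases hd.lt_or_gt with hneg | hpos
  · have hy4 : 4 ≤ y₁ := by
      have h3 : (2 : ℤ) ^ 4 ∣ 2 ^ y₁ * (2 ^ (b + 1) - 1) := by
        rw [← heq, hat]
        exact (Dvd.dvd.trans (by norm_num) (dvd_pow_sub_one_of_dvd (dvd_mul_right 2 t))).mul_left _
      have h4 := Int.prime_two.pow_dvd_of_dvd_mul_right _
        (fun h => by rw [pow_succ] at h; omega) h3
      exact (pow_dvd_pow_iff two_ne_zero (by decide)).1 h4
    obtain ⟨n, rfl⟩ := Nat.exists_eq_add_of_le' hy4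
    have hmod : ∀ k : ℕ, (7 : ℤ) ^ k % 16 = 1 ∨ (7 : ℤ) ^ k % 16 = 7 := by
      intro k
      induction k with
      | zero => simp
      | succ k ih => rw [pow_succ]; omega
    have hd4 : 4 < -d := by
      have h3 := hmod x₁
      rw [pow_add] at h₁
      omega
    refine seven_pow_add_ne_two_pow (D := -d) (t := t) (n := n + 2) (m := n + 2 + (b + 1)) hx₁
      (by omega) hd4 ?_ ?_
    · linarith
    · rw [← hat, show n + 2 + (b + 1) + 2 = n + 4 + b + 1 by ring]
      linarith
  · have hd1 : d ≠ 1 := by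
      rintro rfl
      have h3 : (3 : ℤ) ∣ 2 ^ y₁ := by
        rw [show (2 : ℤ) ^ y₁ = 7 ^ x₁ - 1 by linarith]
        exact Dvd.dvd.trans (by norm_num) (sub_one_dvd_pow_sub_one (7 : ℤ) x₁)
      have := Int.prime_three.dvd_of_dvd_pow h3
      omega
    have hd7 : ¬ (7 : ℤ) ∣ d := fun h => n7 y₁ <| by
      rw [show (2 : ℤ) ^ y₁ = 7 ^ x₁ - d by linarith]
      exact dvd_sub (dvd_pow_self _ hx₁.ne') h
    have hodd := odd_of_form_eq_seven_pow (E := 2 ^ y₁) (x := x₁) (Int.even_pow.2 ⟨even_two, hy₁.ne'⟩)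
      (by positivity) (by omega : 1 < d) hd7 (n7 y₁) (hx := by linarith) (2 ^ u) 1
      (z := x₁ + (a + 1)) (by
        rw [← pow_mul, mul_comm u, ← hbu, ← pow_add, ← add_assoc y₁]
        linarith) (n7 u)
    rw [← Int.not_even_iff_odd] at hodd
    exact hodd (Int.even_pow.2 ⟨even_two, by omega⟩)
end
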